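/- arXiv:2511.09551 — 4 statements merged into one kernel-verified Lean document; each statement's English description precedes it below -/
import Mathlib

section
/- For every y ∈ {0,1}^n with y ≠ 0^n and every integer r ≥ 0, the following operator-norm bounds hold on the ℓ-boson space: ‖G̃_y · Con_r‖_op ≤ √r + √(2 + 4r) and ‖H̃_y · Con_r‖_op ≤ 9r + 9. -/
open scoped BigOperators

/-- The group `{0,1}^n` with bitwise XOR as addition. -/
abbrev BV (n : ℕ) : Type := Fin n → ZMod 2

/-- Occupation tuples: functions assigning a number of bosons to each mode. -/
abbrev OccT (n : ℕ) : Type := BV n → ℕ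

/-- The full bosonic Fock space: formal (finitely supported) complex combinations of
position Fock basis states `|u⟩`, one for each occupation tuple `u`. -/
abbrev FockV (n : ℕ) : Type := OccT n →₀ ℂ

/-- Operators on the Fock space. -/
abbrev FockOp (n : ℕ) : Type := Module.End ℂ (FockV n)

/-- The annihilation operator `â_x`: on basis states, `â_x|u⟩ = √(u_x)|u − 1_x⟩`. -/
noncomputable def ann (n : ℕ) (x : BV n) : FockOp n :=
  Finsupp.lift (FockV n) ℂ (OccT n) fun u =>
    ((Real.sqrt (u x) : ℝ) : ℂ) • Finsupp.single (Function.update u x (u x - 1)) 1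

/-- The creation operator `â_x†`: on basis states, `â_x†|u⟩ = √(u_x + 1)|u + 1_x⟩`. -/
noncomputable def cre (n : ℕ) (x : BV n) : FockOp n :=
  Finsupp.lift (FockV n) ℂ (OccT n) fun u =>
    ((Real.sqrt (u x + 1) : ℝ) : ℂ) • Finsupp.single (Function.update u x (u x + 1)) 1

/-- The number operator `n̂_z = â_z† â_z`. -/
noncomputable def numOp (n : ℕ) (z : BV n) : FockOp n := cre n z * ann n z

/-- The sign `(−1)^{x·y}` (as a real number), `x·y` the mod-2 inner product. -/
noncomputable def chiR {n : ℕ} (x y : BV n) : ℝ :=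
  if (∑ j, x j * y j : ZMod 2) = 0 then 1 else -1

/-- The momentum annihilation operator `ã_y = 2^{−n/2} ∑_x (−1)^{x·y} â_x`. -/
noncomputable def mann (n : ℕ) (y : BV n) : FockOp n :=
  (((Real.sqrt ((2 : ℝ) ^ n))⁻¹ : ℝ) : ℂ) • ∑ x : BV n, ((chiR x y : ℝ) : ℂ) • ann n x

/-- The momentum creation operator `ã_y† = 2^{−n/2} ∑_x (−1)^{x·y} â_x†`. -/
noncomputable def mcre (n : ℕ) (y : BV n) : FockOp n :=
  (((Real.sqrt ((2 : ℝ) ^ n))⁻¹ : ℝ) : ℂ) • ∑ x : BV n, ((chiR x y : ℝ) : ℂ) • cre n x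

/-- The vacuum state `|vac⟩`. -/
noncomputable def vac (n : ℕ) : FockV n := Finsupp.single 0 1

/-- The momentum Fock state `|ũ⟩ = (∏_x (ã_x†)^{u_x}/√(u_x!)) |vac⟩`. -/
noncomputable def momFock (n : ℕ) (u : OccT n) : FockV n :=
  (((∏ x : BV n, Real.sqrt ((u x).factorial) : ℝ)⁻¹ : ℝ) : ℂ) •
    ((Finset.univ.toList (α := BV n)).map fun x => (mcre n x) ^ (u x)).prod (vac n)

/-- The number of modes `x ≠ 0` with an odd number of bosons. -/
def oddCount (n : ℕ) (u : OccT n) : ℕ :=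
  (Finset.univ.filter fun x : BV n => x ≠ 0 ∧ Odd (u x)).card

/-- The orthogonal projection (in the `ℓ`-boson space) onto the span of the momentum Fock
states `|ũ⟩` over occupation tuples `u` with `∑_x u_x = ℓ` satisfying `P`.  Since the
momentum Fock states `{|ũ⟩ : ∑ u = ℓ}` form an orthonormal basis of the `ℓ`-boson space,
this projection equals `∑_u |ũ⟩⟨ũ|`, which on a position basis state `|w⟩` gives
`∑_u conj(⟨w|ũ⟩) |ũ⟩`. -/
noncomputable def projOn (n ℓ : ℕ) (P : OccT n → Prop) [DecidablePred P] : FockOp n :=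
  Finsupp.lift (FockV n) ℂ (OccT n) fun w =>
    ∑ v : BV n → Fin (ℓ + 1),
      if (∑ x, ((v x : ℕ))) = ℓ ∧ P (fun x => (v x : ℕ))
      then (starRingEnd ℂ) (momFock n (fun x => (v x : ℕ)) w) • momFock n (fun x => (v x : ℕ))
      else 0

/-- `Con_r` (`conProj`): the projection onto the span of momentum Fock states of `r`-condensate tuples
(`ℓ`-boson tuples with at least `ℓ − r` bosons in the `0`-momentum mode). -/
noncomputable def conProj (n ℓ r : ℕ) : FockOp n :=
  projOn n ℓ fun u => ℓ - r ≤ u 0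

/-- `QEC_{(r,o)}`: the projection onto the span of momentum Fock states of
`(r,o)`-quasi-even condensate tuples. -/
noncomputable def QEC (n ℓ r o : ℕ) : FockOp n :=
  projOn n ℓ fun u => ℓ - r ≤ u 0 ∧ oddCount n u ≤ o

/-- `QE_{=o}`: the projection onto momentum Fock states with exactly `o` odd
nonzero-momentum modes. -/
noncomputable def QEeq (n ℓ o : ℕ) : FockOp n :=
  projOn n ℓ fun u => oddCount n u = o

/-- `QEC_{(R,=o)}`: the projection onto momentum Fock states of `R`-condensate tuples with
exactly `o` odd nonzero-momentum modes. -/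
noncomputable def QECeq (n ℓ R o : ℕ) : FockOp n :=
  projOn n ℓ fun u => (ℓ - R ≤ u 0 ∧ oddCount n u = o)

/-- The squared Hilbert norm `‖ψ‖² = ∑_u |ψ_u|²`. -/
noncomputable def nsq (n : ℕ) (ψ : FockV n) : ℝ := ψ.sum fun _ c => Complex.normSq c

/-- The inner product `⟨φ, ψ⟩ = ∑_u conj(φ_u) ψ_u` (antilinear in the first argument). -/
noncomputable def finner (n : ℕ) (φ ψ : FockV n) : ℂ :=
  φ.sum fun u c => (starRingEnd ℂ) c * ψ u

/-- The single `y`-momentum hopping operator `G̃_y = ℓ^{−1/2} ∑_x ã_{x⊕y}† ã_x`. -/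
noncomputable def sHop (n ℓ : ℕ) (y : BV n) : FockOp n :=
  (((Real.sqrt (ℓ : ℝ))⁻¹ : ℝ) : ℂ) • ∑ x : BV n, mcre n (x + y) * mann n x

/-- The double `y`-momentum hopping operator
`H̃_y = ℓ^{−1} ∑_{x,x'} ã_{x⊕y}† ã_{x'⊕y}† ã_x ã_{x'}`. -/
noncomputable def dHop (n ℓ : ℕ) (y : BV n) : FockOp n :=
  ((ℓ : ℂ))⁻¹ • ∑ x : BV n, ∑ x' : BV n,
    mcre n (x + y) * mcre n (x' + y) * mann n x * mann n x'

section helpers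
variable {n : ℕ}

theorem upd_succ_pred (u : OccT n) (x : BV n) :
    Function.update (Function.update u x (u x + 1)) x
      ((Function.update u x (u x + 1)) x - 1) = u := by
  simp

theorem upd_pred_succ (u : OccT n) (x : BV n) (h : u x ≠ 0) :
    Function.update (Function.update u x (u x - 1)) x
      ((Function.update u x (u x - 1)) x + 1) = u := by
  have : u x - 1 + 1 = u x := by omega
  simp [this]

theorem ann_single (x : BV n) (u : OccT n) (a : ℂ) :
    ann n x (Finsupp.single u a) =
      Finsupp.single (Function.update u x (u x - 1)) (a * ((Real.sqrt (u x) : ℝ) : ℂ)) := by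
  simp [ann]

theorem cre_single (x : BV n) (u : OccT n) (a : ℂ) :
    cre n x (Finsupp.single u a) =
      Finsupp.single (Function.update u x (u x + 1)) (a * ((Real.sqrt (u x + 1) : ℝ) : ℂ)) := by
  simp [cre]

theorem ann_apply (x : BV n) (φ : FockV n) (u : OccT n) :
    (ann n x φ) u = ((Real.sqrt (u x + 1) : ℝ) : ℂ) * φ (Function.update u x (u x + 1)) := by
  induction φ using Finsupp.induction_linear with
  | zero => simp
  | add f g hf hg => simp [hf, hg, mul_add]
  | single v a =>
    rw [ann_single, Finsupp.single_apply, Finsupp.single_apply]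
    by_cases h : v = Function.update u x (u x + 1)
    · subst h
      simp [mul_comm]
    · rw [if_neg h]
      by_cases h0 : v x = 0
      · simp [h0]
      · rw [if_neg]
        · simp
        · rintro rfl
          exact h (upd_pred_succ v x h0).symm

theorem cre_apply (x : BV n) (φ : FockV n) (u : OccT n) :
    (cre n x φ) u = ((Real.sqrt (u x) : ℝ) : ℂ) * φ (Function.update u x (u x - 1)) := by
  induction φ using Finsupp.induction_linear with
  | zero => simp
  | add f g hf hg => simp [hf, hg, mul_add]
  | single v a =>
    rw [cre_single, Finsupp.single_apply, Finsupp.single_apply]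
    by_cases h : Function.update v x (v x + 1) = u
    · subst h
      simp [mul_comm]
    · rw [if_neg h]
      by_cases h0 : u x = 0
      · simp [h0]
      · rw [if_neg]
        · simp
        · rintro rfl
          exact h (upd_pred_succ u x h0)

theorem cre_ann_apply (x : BV n) (φ : FockV n) (u : OccT n) :
    (cre n x (ann n x φ)) u = (u x : ℂ) * φ u := by
  rw [cre_apply, ann_apply]
  by_cases h : u x = 0
  · simp [h]
  · rw [upd_pred_succ u x h, ← mul_assoc]
    congr 1
    have : ((u x - 1 : ℕ) : ℝ) + 1 = u x := by
      have : u x - 1 + 1 = u x := by omega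
      exact_mod_cast this
    simp only [Function.update_self, this]
    rw [← Complex.ofReal_mul, Real.mul_self_sqrt (by positivity)]
    simp

theorem ann_cre_apply (x : BV n) (φ : FockV n) (u : OccT n) :
    (ann n x (cre n x φ)) u = ((u x : ℂ) + 1) * φ u := by
  rw [ann_apply, cre_apply, upd_succ_pred, ← mul_assoc]
  congr 1
  simp only [Function.update_self, Nat.cast_add, Nat.cast_one]
  rw [← Complex.ofReal_mul, Real.mul_self_sqrt (by positivity)]
  simp

theorem ccr (x y : BV n) (φ : FockV n) :
    ann n x (cre n y φ) = cre n y (ann n x φ) + (if x = y then φ else 0) := by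
  ext u
  by_cases h : x = y
  · subst h
    rw [Finsupp.add_apply, cre_ann_apply, ann_cre_apply]
    simp; ring
  · have h' : y ≠ x := fun e => h e.symm
    rw [Finsupp.add_apply, ann_apply, cre_apply, cre_apply, ann_apply]
    simp only [Function.update_of_ne h, Function.update_of_ne h', if_neg h,
      Finsupp.coe_zero, Pi.zero_apply, add_zero]
    rw [Function.update_comm h]
    ring

theorem cre_comm (x y : BV n) : Commute (cre n x) (cre n y) := by
  by_cases h : x = y
  · subst h; exact Commute.refl _
  have h' : y ≠ x := fun e => h e.symm
  refine LinearMap.ext fun φ => ?_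
  ext u
  simp only [Module.End.mul_apply]
  rw [cre_apply, cre_apply, cre_apply, cre_apply]
  simp only [Function.update_of_ne h, Function.update_of_ne h']
  rw [Function.update_comm h]
  ring

theorem mcre_comm (x y : BV n) : Commute (mcre n x) (mcre n y) := by
  unfold mcre
  refine Commute.smul_left (Commute.smul_right ?_ _) _
  refine Commute.sum_left _ _ _ fun a _ => Commute.sum_right _ _ _ fun b _ => ?_
  exact Commute.smul_left (Commute.smul_right (cre_comm a b) _) _

theorem mann_apply' (y : BV n) (φ : FockV n) :
    mann n y φ = (((Real.sqrt ((2 : ℝ) ^ n))⁻¹ : ℝ) : ℂ) •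
      ∑ x : BV n, ((chiR x y : ℝ) : ℂ) • ann n x φ := by
  simp [mann, LinearMap.sum_apply]

theorem mcre_apply' (y : BV n) (φ : FockV n) :
    mcre n y φ = (((Real.sqrt ((2 : ℝ) ^ n))⁻¹ : ℝ) : ℂ) •
      ∑ x : BV n, ((chiR x y : ℝ) : ℂ) • cre n x φ := by
  simp [mcre, LinearMap.sum_apply]

theorem zmod2_cases (a : ZMod 2) : a = 0 ∨ a = 1 := by
  revert a; decide

theorem chi_add (x y z : BV n) : chiR x y * chiR x z = chiR x (y + z) := by
  unfold chiR
  simp only [Pi.add_apply, mul_add, Finset.sum_add_distrib]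
  generalize (∑ j, x j * y j) = a
  generalize (∑ j, x j * z j) = b
  have h10 : (1 : ZMod 2) ≠ 0 := by decide
  have h11 : (1 : ZMod 2) + 1 = 0 := by decide
  rcases zmod2_cases a with rfl | rfl <;> rcases zmod2_cases b with rfl | rfl <;>
    simp [h10, h11]

theorem chi_add_left (x y z : BV n) : chiR x z * chiR y z = chiR (x + y) z := by
  unfold chiR
  simp only [Pi.add_apply, add_mul, Finset.sum_add_distrib]
  generalize (∑ j, x j * z j) = a
  generalize (∑ j, y j * z j) = b
  have h10 : (1 : ZMod 2) ≠ 0 := by decide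
  have h11 : (1 : ZMod 2) + 1 = 0 := by decide
  rcases zmod2_cases a with rfl | rfl <;> rcases zmod2_cases b with rfl | rfl <;>
    simp [h10, h11]

theorem bv_add_self (y : BV n) : y + y = 0 := by
  ext j; exact CharTwo.add_self_eq_zero _

theorem chi_sum (y : BV n) : ∑ x : BV n, chiR x y = if y = 0 then 2 ^ n else 0 := by
  split_ifs with h
  · subst h
    simp [chiR]
  · obtain ⟨j, hj⟩ : ∃ j, y j ≠ 0 := by
      by_contra hh
      push Not at hh
      exact h (funext hh)
    have hj1 : y j = 1 := by
      generalize y j = a at hj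
      fin_cases a
      · exact absurd rfl hj
      · rfl
    have hc : chiR (Pi.single j 1 : BV n) y = -1 := by
      unfold chiR
      rw [if_neg]
      simp [Pi.single_apply, hj1]
    have h1 : ∑ x : BV n, chiR x y = ∑ x : BV n, chiR (x + Pi.single j 1) y :=
      (Equiv.sum_comp (Equiv.addRight (Pi.single j 1 : BV n)) (fun x => chiR x y)).symm
    have h2 : ∑ x : BV n, chiR (x + Pi.single j 1) y = - ∑ x : BV n, chiR x y := by
      rw [← Finset.sum_neg_distrib]
      refine Finset.sum_congr rfl fun x _ => ?_
      rw [← chi_add_left, hc]; ring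
    linarith

theorem bv_add_eq_zero (x y : BV n) : x + y = 0 ↔ x = y := by
  constructor
  · intro h
    calc x = x + y + y := by rw [add_assoc, bv_add_self, add_zero]
      _ = y := by rw [h, zero_add]
  · rintro rfl; exact bv_add_self x

theorem mccr (x y : BV n) (φ : FockV n) :
    mann n x (mcre n y φ) = mcre n y (mann n x φ) + (if x = y then φ else 0) := by
  have hs : ∑ a : BV n, chiR a x * chiR a y = if x = y then (2:ℝ) ^ n else 0 := by
    simp only [chi_add, chi_sum, bv_add_eq_zero]
  simp only [mann_apply', mcre_apply', map_smul, map_sum, ccr, smul_add, Finset.sum_add_distrib,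
    Finset.smul_sum]
  refine congrArg₂ (· + ·) ?_ ?_
  · rw [Finset.sum_comm]
    refine Finset.sum_congr rfl fun a _ => Finset.sum_congr rfl fun b _ => ?_
    simp only [smul_smul]
    congr 1; ring
  · have : ∀ a : BV n, ∀ b : BV n, (if a = b then φ else 0) = (if a = b then (1:ℂ) else 0) • φ := by
      intro a b; split_ifs <;> simp
    simp only [this, smul_smul, ← Finset.sum_smul]
    have key : (∑ a : BV n, ∑ b : BV n, (((Real.sqrt ((2 : ℝ) ^ n))⁻¹ : ℝ) : ℂ) *
       ((chiR a x : ℂ) * ((((Real.sqrt ((2 : ℝ) ^ n))⁻¹ : ℝ) : ℂ) * ((chiR b y : ℂ) *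
        if a = b then 1 else 0)))) = if x = y then 1 else 0 := by
      simp only [mul_ite, mul_one, mul_zero, Finset.sum_ite_eq, Finset.mem_univ, if_true]
      have h2 : ((((Real.sqrt ((2 : ℝ) ^ n))⁻¹) * ((Real.sqrt ((2 : ℝ) ^ n))⁻¹)) *
          ∑ a : BV n, chiR a x * chiR a y) = if x = y then 1 else 0 := by
        rw [hs, ← mul_inv, Real.mul_self_sqrt (by positivity)]
        split_ifs
        · field_simp
        · simp
      have h3 := congrArg (fun r : ℝ => (r : ℂ)) h2
      simp only [apply_ite (fun r : ℝ => (r : ℂ))] at h3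
      push_cast at h3 ⊢
      rw [← h3, Finset.mul_sum]
      refine Finset.sum_congr rfl fun a _ => ?_
      ring
    rw [← key]
    refine congrArg (fun c : ℂ => c • φ) ?_
    rw [Finset.sum_comm]
    refine Finset.sum_congr rfl fun a _ => Finset.sum_congr rfl fun b _ => ?_
    ring

theorem fock_induction (S : Submodule ℂ (FockV n)) (h0 : vac n ∈ S)
    (hc : ∀ y, ∀ v ∈ S, cre n y v ∈ S) (v : FockV n) : v ∈ S := by
  have key : ∀ k : ℕ, ∀ u : OccT n, ∑ x, u x = k → Finsupp.single u (1:ℂ) ∈ S := by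
    intro k
    induction k with
    | zero =>
      intro u hu
      have : u = 0 := by
        funext x
        have := Finset.sum_eq_zero_iff.mp hu x (Finset.mem_univ x)
        simpa using this
      subst this; exact h0
    | succ k ih =>
      intro u hu
      obtain ⟨y, hy⟩ : ∃ y, u y ≠ 0 := by
        by_contra hh
        push Not at hh
        simp [hh] at hu
      have h1 := ih (Function.update u y (u y - 1)) (by
        rw [Finset.sum_update_of_mem (Finset.mem_univ y)]
        rw [← Finset.add_sum_erase _ _ (Finset.mem_univ y)] at hu
        rw [Finset.sdiff_singleton_eq_erase]
        omega)
      have h2 := hc y _ h1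
      rw [cre_single, upd_pred_succ u y hy] at h2
      have h3 := S.smul_mem
        ((((Real.sqrt (((Function.update u y (u y - 1)) y : ℕ) + 1) : ℝ) : ℂ))⁻¹) h2
      rw [Finsupp.smul_single, smul_eq_mul, one_mul, inv_mul_cancel₀] at h3
      · exact h3
      · rw [Complex.ofReal_ne_zero]; positivity
  induction v using Finsupp.induction_linear with
  | zero => exact S.zero_mem
  | add f g hf hg => exact S.add_mem hf hg
  | single u a =>
    have := S.smul_mem a (key _ u rfl)
    simpa using this

/-- The unitary sending position Fock states to momentum Fock states. -/
noncomputable def MM (n : ℕ) : FockOp n :=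
  Finsupp.lift (FockV n) ℂ (OccT n) (momFock n)

theorem MM_single (u : OccT n) (a : ℂ) : MM n (Finsupp.single u a) = a • momFock n u := by
  simp [MM]

theorem list_prod_update {ι R : Type*} [DecidableEq ι] [Monoid R] (f : ι → R)
    (hf : ∀ x y, Commute (f x) (f y)) (u : ι → ℕ) (y : ι) (L : List ι) (hL : L.Nodup) :
    (L.map fun x => f x ^ (Function.update u y (u y + 1) x)).prod =
      (if y ∈ L then f y else 1) * (L.map fun x => f x ^ u x).prod := by
  induction L with
  | nil => simp
  | cons a L ih =>
    rw [List.nodup_cons] at hL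
    have ih := ih hL.2
    rw [List.map_cons, List.map_cons, List.prod_cons, List.prod_cons, ih]
    by_cases h : a = y
    · subst h
      simp [hL.1, pow_succ', mul_assoc]
    · have h' : y ≠ a := fun e => h e.symm
      rw [Function.update_of_ne h]
      by_cases hy : y ∈ L
      · simp only [hy, List.mem_cons, or_true, if_true]
        rw [← mul_assoc, ← mul_assoc, ((hf a y).pow_left _).eq]
      · simp [hy, h']

theorem prod_fact_update (u : OccT n) (y : BV n) :
    (∏ x : BV n, Real.sqrt (((Function.update u y (u y + 1) x).factorial : ℕ) : ℝ)) =
      Real.sqrt (u y + 1) * ∏ x : BV n, Real.sqrt ((u x).factorial) := by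
  rw [← Finset.mul_prod_erase _ _ (Finset.mem_univ y),
    ← Finset.mul_prod_erase _ (fun x => Real.sqrt ((u x).factorial)) (Finset.mem_univ y),
    ← mul_assoc]
  congr 1
  · rw [Function.update_self, Nat.factorial_succ, Nat.cast_mul, Real.sqrt_mul (by positivity)]
    push_cast; rfl
  · refine Finset.prod_congr rfl fun x hx => ?_
    rw [Function.update_of_ne (Finset.ne_of_mem_erase hx)]

theorem mcre_momFock (u : OccT n) (y : BV n) :
    mcre n y (momFock n u) =
      ((Real.sqrt (u y + 1) : ℝ) : ℂ) • momFock n (Function.update u y (u y + 1)) := by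
  unfold momFock
  rw [list_prod_update (mcre n) mcre_comm u y _ (Finset.nodup_toList _), prod_fact_update]
  simp only [Finset.mem_toList, Finset.mem_univ, if_true, map_smul, Module.End.mul_apply,
    smul_smul]
  congr 1
  have h : (Real.sqrt ((u y : ℝ) + 1)) ≠ 0 := by positivity
  rw [← Complex.ofReal_mul, mul_inv, ← mul_assoc, mul_inv_cancel₀ h, one_mul]

theorem MM_cre (y : BV n) (φ : FockV n) : MM n (cre n y φ) = mcre n y (MM n φ) := by
  induction φ using Finsupp.induction_linear with
  | zero => simp
  | add f g hf hg => simp [hf, hg]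
  | single u a =>
    rw [cre_single, MM_single, MM_single, map_smul, mcre_momFock, smul_smul]

theorem MM_vac : MM n (vac n) = vac n := by
  have : momFock n 0 = vac n := by
    simp [momFock]
  rw [vac, MM_single, this, one_smul, vac]

theorem ann_vac (x : BV n) : ann n x (vac n) = 0 := by
  simp [vac, ann_single]

theorem mann_vac (x : BV n) : mann n x (vac n) = 0 := by
  simp [mann_apply', ann_vac]

theorem MM_ann (x : BV n) (φ : FockV n) : MM n (ann n x φ) = mann n x (MM n φ) := by
  revert x
  let S : Submodule ℂ (FockV n) :=
    { carrier := {φ | ∀ x, MM n (ann n x φ) = mann n x (MM n φ)}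
      add_mem' := by
        intro a b ha hb x
        simp only [map_add, ha x, hb x]
      zero_mem' := by intro x; simp
      smul_mem' := by
        intro c a ha x
        simp only [map_smul, ha x] }
  refine fock_induction S ?_ ?_ φ
  · intro x
    rw [ann_vac, MM_vac, mann_vac, map_zero]
  · intro y v hv x
    have hv : ∀ x, MM n (ann n x v) = mann n x (MM n v) := hv
    rw [ccr, MM_cre, mccr, map_add, MM_cre, hv]
    split_ifs <;> simp

theorem finner_eq (φ ψ : FockV n) (s : Finset (OccT n)) (hs : φ.support ⊆ s) :
    finner n φ ψ = ∑ u ∈ s, (starRingEnd ℂ) (φ u) * ψ u := by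
  unfold finner
  rw [Finsupp.sum_of_support_subset _ hs]
  simp

theorem finner_single (u : OccT n) (a : ℂ) (ψ : FockV n) :
    finner n (Finsupp.single u a) ψ = (starRingEnd ℂ) a * ψ u := by
  simp [finner]

theorem finner_zero (ψ : FockV n) : finner n 0 ψ = 0 := by
  simp [finner]

theorem finner_add (φ φ' ψ : FockV n) :
    finner n (φ + φ') ψ = finner n φ ψ + finner n φ' ψ := by
  classical
  rw [finner_eq φ ψ (φ.support ∪ φ'.support) Finset.subset_union_left,
    finner_eq φ' ψ (φ.support ∪ φ'.support) Finset.subset_union_right,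
    finner_eq _ ψ (φ.support ∪ φ'.support) Finsupp.support_add, ← Finset.sum_add_distrib]
  refine Finset.sum_congr rfl fun u _ => ?_
  simp [add_mul]

theorem finner_smul (c : ℂ) (φ ψ : FockV n) :
    finner n (c • φ) ψ = (starRingEnd ℂ) c * finner n φ ψ := by
  rw [finner_eq φ ψ φ.support subset_rfl,
    finner_eq _ ψ φ.support Finsupp.support_smul, Finset.mul_sum]
  refine Finset.sum_congr rfl fun u _ => ?_
  simp [mul_assoc]

theorem finner_symm (φ ψ : FockV n) :
    (starRingEnd ℂ) (finner n ψ φ) = finner n φ ψ := by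
  classical
  rw [finner_eq φ ψ (φ.support ∪ ψ.support) Finset.subset_union_left,
    finner_eq ψ φ (φ.support ∪ ψ.support) Finset.subset_union_right, map_sum]
  refine Finset.sum_congr rfl fun u _ => ?_
  simp [mul_comm]

theorem nsq_eq_sum (φ : FockV n) : nsq n φ = ∑ u ∈ φ.support, Complex.normSq (φ u) := rfl

theorem nsq_nonneg (φ : FockV n) : 0 ≤ nsq n φ := by
  rw [nsq_eq_sum]
  exact Finset.sum_nonneg fun u _ => Complex.normSq_nonneg _

theorem finner_self (φ : FockV n) : finner n φ φ = (nsq n φ : ℂ) := by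
  rw [finner_eq φ φ φ.support subset_rfl, nsq_eq_sum, Complex.ofReal_sum]
  refine Finset.sum_congr rfl fun u _ => ?_
  rw [Complex.normSq_eq_conj_mul_self]

theorem finner_self_re (φ : FockV n) : nsq n φ = (finner n φ φ).re := by
  rw [finner_self, Complex.ofReal_re]

/-- The inner product core. -/
noncomputable def fcore (n : ℕ) : InnerProductSpace.Core ℂ (FockV n) where
  inner := finner n
  conj_inner_symm := fun x y => finner_symm x y
  re_inner_nonneg := fun x => by
    change 0 ≤ (finner n x x).re
    rw [← finner_self_re]; exact nsq_nonneg x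
  add_left := finner_add
  smul_left := fun x y c => finner_smul c x y
  definite := fun x hx => by
    change finner n x x = 0 at hx
    rw [finner_self, Complex.ofReal_eq_zero, nsq_eq_sum,
      Finset.sum_eq_zero_iff_of_nonneg (fun u _ => Complex.normSq_nonneg _)] at hx
    ext u
    by_cases hu : u ∈ x.support
    · simpa using hx u hu
    · simpa using hu

/-- The Hilbert norm. -/
noncomputable def nrm (φ : FockV n) : ℝ := Real.sqrt (nsq n φ)

theorem nrm_sq (φ : FockV n) : nrm φ ^ 2 = nsq n φ := Real.sq_sqrt (nsq_nonneg φ)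

theorem nrm_nonneg (φ : FockV n) : 0 ≤ nrm φ := Real.sqrt_nonneg _

theorem nrm_add (φ ψ : FockV n) : nrm (φ + ψ) ≤ nrm φ + nrm ψ := by
  let _ : NormedAddCommGroup (FockV n) := (fcore n).toNormedAddCommGroup
  have h : ∀ φ : FockV n, ‖φ‖ = nrm φ := by
    intro φ
    unfold nrm
    rw [finner_self_re]
    rfl
  rw [← h, ← h, ← h]
  exact norm_add_le φ ψ

theorem abs_finner_le (φ ψ : FockV n) : ‖finner n φ ψ‖ ≤ nrm φ * nrm ψ := by
  let _ : NormedAddCommGroup (FockV n) := (fcore n).toNormedAddCommGroup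
  let _ : InnerProductSpace ℂ (FockV n) := InnerProductSpace.ofCore (fcore n).toCore
  have h : ∀ φ : FockV n, ‖φ‖ = nrm φ := by
    intro φ
    unfold nrm
    rw [finner_self_re]
    rfl
  rw [← h, ← h]
  exact norm_inner_le_norm (𝕜 := ℂ) φ ψ

theorem nsq_smul (c : ℂ) (φ : FockV n) : nsq n (c • φ) = ‖c‖ ^ 2 * nsq n φ := by
  rw [nsq_eq_sum φ, finner_self_re, finner_eq (c • φ) (c • φ) φ.support Finsupp.support_smul,
    Complex.re_sum, Finset.mul_sum]
  refine Finset.sum_congr rfl fun u _ => ?_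
  rw [← Complex.normSq_eq_conj_mul_self, Complex.ofReal_re, Finsupp.smul_apply, smul_eq_mul,
    Complex.normSq_mul, Complex.normSq_eq_norm_sq c]

theorem nrm_smul (c : ℂ) (φ : FockV n) : nrm (c • φ) = ‖c‖ * nrm φ := by
  unfold nrm
  rw [nsq_smul, Real.sqrt_mul (by positivity), Real.sqrt_sq (norm_nonneg _)]

theorem finner_add_right (φ ψ ψ' : FockV n) :
    finner n φ (ψ + ψ') = finner n φ ψ + finner n φ ψ' := by
  rw [← finner_symm, finner_add, map_add, finner_symm, finner_symm]

theorem finner_smul_right (c : ℂ) (φ ψ : FockV n) :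
    finner n φ (c • ψ) = c * finner n φ ψ := by
  rw [← finner_symm, finner_smul, map_mul, finner_symm, Complex.conj_conj]

theorem finner_zero_right (φ : FockV n) : finner n φ 0 = 0 := by
  simp [finner]

theorem finner_sum {ι : Type*} (s : Finset ι) (f : ι → FockV n) (ψ : FockV n) :
    finner n (∑ i ∈ s, f i) ψ = ∑ i ∈ s, finner n (f i) ψ := by
  classical
  induction s using Finset.induction_on with
  | empty => simp [finner_zero]
  | insert a s ha ih => rw [Finset.sum_insert ha, Finset.sum_insert ha, finner_add, ih]

theorem finner_sum_right {ι : Type*} (s : Finset ι) (f : ι → FockV n) (ψ : FockV n) :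
    finner n ψ (∑ i ∈ s, f i) = ∑ i ∈ s, finner n ψ (f i) := by
  classical
  induction s using Finset.induction_on with
  | empty => simp [finner_zero_right]
  | insert a s ha ih => rw [Finset.sum_insert ha, Finset.sum_insert ha, finner_add_right, ih]

theorem cre_adj (y : BV n) (φ ψ : FockV n) :
    finner n (cre n y φ) ψ = finner n φ (ann n y ψ) := by
  induction φ using Finsupp.induction_linear with
  | zero => simp [finner_zero]
  | add f g hf hg => simp [hf, hg, finner_add]
  | single u a =>
    rw [cre_single, finner_single, finner_single, ann_apply, map_mul, Complex.conj_ofReal,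
      mul_assoc]

theorem mcre_adj (y : BV n) (φ ψ : FockV n) :
    finner n (mcre n y φ) ψ = finner n φ (mann n y ψ) := by
  rw [mcre_apply', mann_apply', finner_smul, finner_smul_right, finner_sum, finner_sum_right,
    Complex.conj_ofReal]
  congr 1
  refine Finset.sum_congr rfl fun x _ => ?_
  rw [finner_smul, finner_smul_right, Complex.conj_ofReal, cre_adj]

theorem ann_adj (y : BV n) (φ ψ : FockV n) :
    finner n (ann n y φ) ψ = finner n φ (cre n y ψ) := by
  rw [← finner_symm, ← cre_adj, finner_symm]

theorem mann_adj (y : BV n) (φ ψ : FockV n) :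
    finner n (mann n y φ) ψ = finner n φ (mcre n y ψ) := by
  rw [← finner_symm, ← mcre_adj, finner_symm]

theorem MM_vac_inner (w : FockV n) : finner n (vac n) (MM n w) = finner n (vac n) w := by
  let S : Submodule ℂ (FockV n) :=
    { carrier := {w | finner n (vac n) (MM n w) = finner n (vac n) w}
      add_mem' := by
        intro a b ha hb
        simp only [Set.mem_ofPred_eq, map_add, finner_add_right] at *
        rw [ha, hb]
      zero_mem' := by simp
      smul_mem' := by
        intro c a ha
        simp only [Set.mem_ofPred_eq, map_smul, finner_smul_right] at *
        rw [ha] }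
  refine fock_induction S ?_ ?_ w
  · change finner n (vac n) (MM n (vac n)) = finner n (vac n) (vac n)
    rw [MM_vac]
  · intro y v _
    change finner n (vac n) (MM n (cre n y v)) = finner n (vac n) (cre n y v)
    rw [MM_cre, ← mann_adj, ← ann_adj, mann_vac, ann_vac, finner_zero, finner_zero]

theorem MM_isom (v w : FockV n) : finner n (MM n v) (MM n w) = finner n v w := by
  revert w
  let S : Submodule ℂ (FockV n) :=
    { carrier := {v | ∀ w, finner n (MM n v) (MM n w) = finner n v w}
      add_mem' := by
        intro a b ha hb w
        simp only [Set.mem_ofPred_eq] at ha hb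
        rw [map_add, finner_add, finner_add, ha, hb]
      zero_mem' := by intro w; simp [finner_zero]
      smul_mem' := by
        intro c a ha w
        simp only [Set.mem_ofPred_eq] at ha
        rw [map_smul, finner_smul, finner_smul, ha] }
  refine fock_induction S ?_ ?_ v
  · intro w
    rw [MM_vac, MM_vac_inner]
  · intro y v hv w
    have hv : ∀ w, finner n (MM n v) (MM n w) = finner n v w := hv
    rw [MM_cre, mcre_adj, ← MM_ann, hv, cre_adj]

theorem MM_nsq (v : FockV n) : nsq n (MM n v) = nsq n v := by
  rw [finner_self_re, finner_self_re, MM_isom]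

/-- The set of momentum tuples defining `Con_r`. -/
noncomputable def conSet (n ℓ r : ℕ) : Finset (OccT n) :=
  (Finset.univ.filter fun v : BV n → Fin (ℓ + 1) =>
    (∑ x, ((v x : ℕ))) = ℓ ∧ ℓ - r ≤ (v 0 : ℕ)).image fun v x => (v x : ℕ)

theorem conProj_eq (ℓ r : ℕ) (ψ : FockV n) :
    conProj n ℓ r ψ =
      MM n (∑ u ∈ conSet n ℓ r, Finsupp.single u (finner n (momFock n u) ψ)) := by
  have hinj : Function.Injective (fun (v : BV n → Fin (ℓ + 1)) (x : BV n) => (v x : ℕ)) := by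
    intro v w h
    funext x
    exact Fin.ext (congrFun h x)
  rw [map_sum, conSet, Finset.sum_image (fun a _ b _ h => hinj h), Finset.sum_filter]
  simp only [MM_single]
  unfold conProj projOn
  induction ψ using Finsupp.induction_linear with
  | zero => simp [finner_zero_right]
  | add f g hf hg =>
    rw [map_add, hf, hg, ← Finset.sum_add_distrib]
    refine Finset.sum_congr rfl fun v _ => ?_
    split_ifs
    · rw [finner_add_right, add_smul]
    · simp
  | single w a =>
    rw [Finsupp.lift_apply, Finsupp.sum_single_index (by simp), Finset.smul_sum]
    refine Finset.sum_congr rfl fun v _ => ?_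
    split_ifs
    · rw [← finner_symm, finner_single, smul_smul, map_mul, Complex.conj_conj]
    · simp

/-- Support condition: `ℓ` bosons of which at least `ℓ - r` in mode `0`. -/
def IsCon (ℓ r : ℕ) (c : FockV n) : Prop :=
  ∀ u, c u ≠ 0 → ∑ x, u x = ℓ ∧ ℓ ≤ u 0 + r

theorem conProj_spec (ℓ r : ℕ) (ψ : FockV n) :
    ∃ c : FockV n, IsCon ℓ r c ∧ conProj n ℓ r ψ = MM n c ∧ nrm c ≤ nrm ψ := by
  classical
  refine ⟨_, ?_, conProj_eq ℓ r ψ, ?_⟩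
  · intro u hu
    rw [Finsupp.finsetSum_apply] at hu
    obtain ⟨v, hv, hvu⟩ := Finset.exists_ne_zero_of_sum_ne_zero hu
    rw [Finsupp.single_apply] at hvu
    have : v = u := by
      by_contra h; simp [h] at hvu
    subst this
    simp only [conSet, Finset.mem_image, Finset.mem_filter, Finset.mem_univ, true_and] at hv
    obtain ⟨w, ⟨h1, h2⟩, rfl⟩ := hv
    exact ⟨h1, by dsimp only; omega⟩
  · set f : OccT n → ℂ := fun u => finner n (momFock n u) ψ with hf
    set c : FockV n := ∑ u ∈ conSet n ℓ r, Finsupp.single u (f u) with hc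
    have hcu : ∀ u ∈ conSet n ℓ r, c u = f u := by
      intro u hu
      rw [hc, Finsupp.finsetSum_apply]
      simp [Finsupp.single_apply, hu]
    have h1 : finner n (MM n c) ψ = finner n c c := by
      conv_lhs => rw [hc]
      conv_rhs => rw [hc]
      rw [map_sum, finner_sum, finner_sum]
      refine Finset.sum_congr rfl fun u hu => ?_
      rw [MM_single, finner_smul, finner_single, ← hc, hcu u hu]
    have h2 := abs_finner_le (MM n c) ψ
    rw [h1, finner_self, Complex.norm_real, Real.norm_of_nonneg (nsq_nonneg c)] at h2
    have h3 : nrm (MM n c) = nrm c := by unfold nrm; rw [MM_nsq]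
    rw [h3, ← nrm_sq] at h2
    rcases (nrm_nonneg c).eq_or_lt with h | h
    · rw [← h]; exact nrm_nonneg ψ
    · exact le_of_mul_le_mul_left (by rw [← sq]; exact h2) h

theorem nsq_ann (x : BV n) (φ : FockV n) :
    nsq n (ann n x φ) = ∑ u ∈ φ.support, (u x : ℝ) * Complex.normSq (φ u) := by
  rw [finner_self_re, ann_adj, finner_eq φ _ φ.support subset_rfl, Complex.re_sum]
  refine Finset.sum_congr rfl fun u _ => ?_
  rw [cre_ann_apply, mul_left_comm, ← Complex.normSq_eq_conj_mul_self]
  simp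

theorem nsq_cre (x : BV n) (φ : FockV n) :
    nsq n (cre n x φ) = ∑ u ∈ φ.support, ((u x : ℝ) + 1) * Complex.normSq (φ u) := by
  rw [finner_self_re, cre_adj, finner_eq φ _ φ.support subset_rfl, Complex.re_sum]
  refine Finset.sum_congr rfl fun u _ => ?_
  rw [ann_cre_apply, mul_left_comm, ← Complex.normSq_eq_conj_mul_self]
  simp

theorem sum_nsq_ann_le (s : Finset (BV n)) (φ : FockV n) (k : ℕ)
    (h : ∀ u, φ u ≠ 0 → ∑ x ∈ s, u x ≤ k) :
    ∑ x ∈ s, nsq n (ann n x φ) ≤ k * nsq n φ := by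
  simp only [nsq_ann]
  rw [Finset.sum_comm, nsq_eq_sum, Finset.mul_sum]
  refine Finset.sum_le_sum fun u hu => ?_
  rw [← Finset.sum_mul]
  refine mul_le_mul_of_nonneg_right ?_ (Complex.normSq_nonneg _)
  exact_mod_cast h u (by simpa using hu)

theorem nsq_ann_le (x : BV n) (φ : FockV n) (k : ℕ)
    (h : ∀ u, φ u ≠ 0 → u x ≤ k) : nsq n (ann n x φ) ≤ k * nsq n φ := by
  have := sum_nsq_ann_le {x} φ k (by simpa using h)
  simpa using this

theorem nsq_cre_le (x : BV n) (φ : FockV n) (k : ℕ)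
    (h : ∀ u, φ u ≠ 0 → u x + 1 ≤ k) : nsq n (cre n x φ) ≤ k * nsq n φ := by
  rw [nsq_cre, nsq_eq_sum, Finset.mul_sum]
  refine Finset.sum_le_sum fun u hu => ?_
  refine mul_le_mul_of_nonneg_right ?_ (Complex.normSq_nonneg _)
  exact_mod_cast h u (by simpa using hu)

theorem sum_upd_succ (u : OccT n) (x : BV n) :
    ∑ z, Function.update u x (u x + 1) z = ∑ z, u z + 1 := by
  rw [Finset.sum_update_of_mem (Finset.mem_univ x), Finset.sdiff_singleton_eq_erase,
    ← Finset.add_sum_erase _ u (Finset.mem_univ x)]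
  omega

theorem sum_upd_pred (u : OccT n) (x : BV n) (h : u x ≠ 0) :
    ∑ z, Function.update u x (u x - 1) z + 1 = ∑ z, u z := by
  rw [Finset.sum_update_of_mem (Finset.mem_univ x), Finset.sdiff_singleton_eq_erase,
    ← Finset.add_sum_erase _ u (Finset.mem_univ x)]
  omega

theorem hop_support (x z : BV n) (c : FockV n) (u : OccT n)
    (h : (cre n z (ann n x c)) u ≠ 0) :
    ∃ v : OccT n, c v ≠ 0 ∧ ∑ t, v t = ∑ t, u t ∧ v 0 ≤ u 0 + 1 ∧
      (x ≠ 0 → z ≠ 0 → v 0 = u 0) := by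
  rw [cre_apply, ann_apply] at h
  have hz : u z ≠ 0 := by
    intro h0; simp [h0] at h
  refine ⟨_, right_ne_zero_of_mul (right_ne_zero_of_mul h), ?_, ?_, ?_⟩
  · rw [sum_upd_succ, sum_upd_pred u z hz]
  · simp only [Function.update_apply]
    split_ifs <;> (try subst_vars) <;> omega
  · intro hx hz0
    rw [Function.update_of_ne hx.symm, Function.update_of_ne hz0.symm]

theorem IsCon.sum {ι : Type*} {ℓ r : ℕ} (s : Finset ι) (f : ι → FockV n)
    (h : ∀ i ∈ s, IsCon ℓ r (f i)) : IsCon ℓ r (∑ i ∈ s, f i) := by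
  intro u hu
  rw [Finsupp.finsetSum_apply] at hu
  obtain ⟨i, hi, hiu⟩ := Finset.exists_ne_zero_of_sum_ne_zero hu
  exact h i hi u hiu

theorem IsCon.hop {ℓ r : ℕ} {c : FockV n} (h : IsCon ℓ r c) (x z : BV n) :
    IsCon ℓ (r + 1) (cre n z (ann n x c)) := by
  intro u hu
  obtain ⟨v, hv, h1, h2, -⟩ := hop_support x z c u hu
  obtain ⟨h3, h4⟩ := h v hv
  exact ⟨h1 ▸ h3, by omega⟩

theorem IsCon.hop' {ℓ r : ℕ} {c : FockV n} (h : IsCon ℓ r c) (x z : BV n) (hx : x ≠ 0)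
    (hz : z ≠ 0) : IsCon ℓ r (cre n z (ann n x c)) := by
  intro u hu
  obtain ⟨v, hv, h1, -, h2⟩ := hop_support x z c u hu
  obtain ⟨h3, h4⟩ := h v hv
  exact ⟨h1 ▸ h3, by have := h2 hx hz; omega⟩

/-- The unnormalised hopping operator in the position-like representation. -/
noncomputable def KK (y : BV n) (c : FockV n) : FockV n := ∑ x, cre n (x + y) (ann n x c)

/-- The part of the hopping operator not touching the condensate mode. -/
noncomputable def BB (y : BV n) (c : FockV n) : FockV n :=
  ∑ x ∈ (Finset.univ.erase (0 : BV n)).erase y, cre n (x + y) (ann n x c)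

theorem KK_split (y : BV n) (hy : y ≠ 0) (c : FockV n) :
    KK y c = (cre n y (ann n 0 c) + cre n 0 (ann n y c)) + BB y c := by
  unfold KK BB
  rw [← Finset.add_sum_erase _ _ (Finset.mem_univ (0 : BV n)),
    ← Finset.add_sum_erase _ _ (Finset.mem_erase.mpr ⟨hy, Finset.mem_univ y⟩), zero_add,
    bv_add_self, add_assoc]

theorem BB_nrm (y : BV n) (c : FockV n) (ℓ r k : ℕ) (hc : IsCon ℓ r c)
    (hk : ∀ u : OccT n, ∑ x, u x = ℓ → ℓ ≤ u 0 + r →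
      ∑ x ∈ Finset.univ.erase (0 : BV n), u x ≤ k) :
    nrm (BB y c) ≤ k * nrm c := by
  set s := (Finset.univ.erase (0 : BV n)).erase y with hs
  have hmem : ∀ x ∈ s, x ≠ 0 ∧ x + y ≠ 0 := by
    intro x hx
    rw [hs, Finset.mem_erase, Finset.mem_erase] at hx
    exact ⟨hx.2.1, fun h => hx.1 ((bv_add_eq_zero x y).mp h)⟩
  have hB : IsCon ℓ r (BB y c) :=
    IsCon.sum _ _ fun x hx => hc.hop' x (x + y) (hmem x hx).1 (hmem x hx).2
  have h1 : ∀ d : FockV n, IsCon ℓ r d →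
      ∑ x ∈ Finset.univ.erase (0 : BV n), nsq n (ann n x d) ≤ k * nsq n d := by
    intro d hd
    exact sum_nsq_ann_le _ d k fun u hu => hk u (hd u hu).1 (hd u hu).2
  have h2 : ∑ x ∈ s, nrm (ann n x c) ^ 2 ≤ k * nsq n c := by
    refine le_trans ?_ (h1 c hc)
    simp only [nrm_sq]
    exact Finset.sum_le_sum_of_subset_of_nonneg (Finset.erase_subset _ _)
      fun x _ _ => nsq_nonneg _
  have h3 : ∑ x ∈ s, nrm (ann n (x + y) (BB y c)) ^ 2 ≤ k * nsq n (BB y c) := by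
    refine le_trans ?_ (h1 _ hB)
    simp only [nrm_sq]
    rw [← Finset.sum_image (f := fun x => nsq n (ann n x (BB y c))) (s := s) (g := fun x => x + y)
      (fun a _ b _ h => add_right_cancel h)]
    refine Finset.sum_le_sum_of_subset_of_nonneg ?_ fun x _ _ => nsq_nonneg _
    intro z hz
    obtain ⟨x, hx, rfl⟩ := Finset.mem_image.mp hz
    exact Finset.mem_erase.mpr ⟨(hmem x hx).2, Finset.mem_univ _⟩
  have h4 : nsq n (BB y c) ≤ ∑ x ∈ s, nrm (ann n x c) * nrm (ann n (x + y) (BB y c)) := by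
    have e : finner n (BB y c) (BB y c) =
        ∑ x ∈ s, finner n (ann n x c) (ann n (x + y) (BB y c)) := by
      conv_lhs => enter [2]; rw [BB]
      rw [finner_sum]
      exact Finset.sum_congr rfl fun x _ => cre_adj _ _ _
    have e2 : nsq n (BB y c) = ‖finner n (BB y c) (BB y c)‖ := by
      rw [finner_self, Complex.norm_real, Real.norm_of_nonneg (nsq_nonneg _)]
    rw [e2, e]
    exact (norm_sum_le _ _).trans (Finset.sum_le_sum fun x _ => abs_finner_le _ _)
  have h5 : (nrm (BB y c) ^ 2) ^ 2 ≤ (k * nrm (BB y c) * nrm c) ^ 2 := by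
    calc (nrm (BB y c) ^ 2) ^ 2 = nsq n (BB y c) ^ 2 := by rw [nrm_sq]
      _ ≤ (∑ x ∈ s, nrm (ann n x c) * nrm (ann n (x + y) (BB y c))) ^ 2 :=
        pow_le_pow_left₀ (nsq_nonneg _) h4 2
      _ ≤ (∑ x ∈ s, nrm (ann n x c) ^ 2) * ∑ x ∈ s, nrm (ann n (x + y) (BB y c)) ^ 2 :=
        Finset.sum_mul_sq_le_sq_mul_sq _ _ _
      _ ≤ (k * nsq n c) * (k * nsq n (BB y c)) :=
        mul_le_mul h2 h3 (Finset.sum_nonneg fun x _ => sq_nonneg _)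
          (mul_nonneg (Nat.cast_nonneg _) (nsq_nonneg _))
      _ = _ := by rw [← nrm_sq, ← nrm_sq]; ring
  have h6 := (sq_le_sq₀ (sq_nonneg _) (mul_nonneg (mul_nonneg (Nat.cast_nonneg k)
    (nrm_nonneg _)) (nrm_nonneg _))).mp h5
  rcases (nrm_nonneg (BB y c)).eq_or_lt with h | h
  · rw [← h]; exact mul_nonneg (Nat.cast_nonneg _) (nrm_nonneg _)
  · refine le_of_mul_le_mul_left ?_ h
    nlinarith

theorem nrm_le_of_nsq {φ ψ : FockV n} {a : ℝ} (ha : 0 ≤ a) (h : nsq n φ ≤ a * nsq n ψ) :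
    nrm φ ≤ Real.sqrt a * nrm ψ := by
  unfold nrm
  rw [← Real.sqrt_mul ha]
  exact Real.sqrt_le_sqrt h

theorem KK_nrm (y : BV n) (hy : y ≠ 0) (c : FockV n) (ℓ r : ℕ) (hc : IsCon ℓ r c) :
    nrm (KK y c) ≤
      Real.sqrt ℓ * (Real.sqrt (r : ℝ) + Real.sqrt (2 + 4 * (r : ℝ))) * nrm c := by
  have hsum0 : ∀ u : OccT n, u 0 + ∑ x ∈ Finset.univ.erase (0 : BV n), u x = ∑ x, u x :=
    fun u => Finset.add_sum_erase _ u (Finset.mem_univ 0)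
  have hyle : ∀ u : OccT n, u 0 + u y ≤ ∑ x, u x := by
    intro u
    rw [← hsum0]
    exact Nat.add_le_add_left (Finset.single_le_sum (f := u) (fun _ _ => Nat.zero_le _)
      (Finset.mem_erase.mpr ⟨hy, Finset.mem_univ y⟩)) _
  have a1 : nsq n (ann n 0 c) ≤ ℓ * nsq n c := nsq_ann_le 0 c ℓ fun u hu => by
    have := hc u hu; have := hyle u; omega
  have a2 : nsq n (ann n y c) ≤ r * nsq n c := nsq_ann_le y c r fun u hu => by
    have := hc u hu; have := hyle u; omega
  have b1 : nsq n (cre n y (ann n 0 c)) ≤ ((r + 1 : ℕ) : ℝ) * nsq n (ann n 0 c) := by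
    refine nsq_cre_le y _ _ fun u hu => ?_
    rw [ann_apply] at hu
    obtain ⟨h1, h2⟩ := hc _ (right_ne_zero_of_mul hu)
    rw [sum_upd_succ] at h1
    have := hyle u
    rw [Function.update_self] at h2
    omega
  have b2 : nsq n (cre n 0 (ann n y c)) ≤ (ℓ : ℝ) * nsq n (ann n y c) := by
    refine nsq_cre_le 0 _ _ fun u hu => ?_
    rw [ann_apply] at hu
    obtain ⟨h1, h2⟩ := hc _ (right_ne_zero_of_mul hu)
    rw [sum_upd_succ] at h1
    have := hyle u
    omega
  have hA : nrm (cre n y (ann n 0 c) + cre n 0 (ann n y c)) ≤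
      Real.sqrt ((ℓ : ℝ) * (2 + 4 * r)) * nrm c := by
    set α := cre n y (ann n 0 c)
    set β := cre n 0 (ann n y c)
    refine nrm_le_of_nsq (by positivity) ?_
    have h1 := nrm_add α β
    have h2 : nsq n (α + β) ≤ 2 * (nsq n α + nsq n β) := by
      rw [← nrm_sq, ← nrm_sq, ← nrm_sq]
      nlinarith [nrm_nonneg (α + β), nrm_nonneg α, nrm_nonneg β, sq_nonneg (nrm α - nrm β)]
    have h3 : nsq n α ≤ ((r : ℝ) + 1) * (ℓ * nsq n c) := by
      refine b1.trans ?_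
      push_cast
      exact mul_le_mul_of_nonneg_left a1 (by positivity)
    have h4 : nsq n β ≤ ℓ * (r * nsq n c) :=
      b2.trans (mul_le_mul_of_nonneg_left a2 (by positivity))
    nlinarith
  have hB : nrm (BB y c) ≤ ((min r ℓ : ℕ) : ℝ) * nrm c := by
    refine BB_nrm y c ℓ r _ hc fun u h1 h2 => ?_
    have := hsum0 u
    omega
  have hm : ((min r ℓ : ℕ) : ℝ) ≤ Real.sqrt ((ℓ : ℝ) * r) := by
    refine Real.le_sqrt_of_sq_le ?_
    rw [sq]
    exact mul_le_mul (by exact_mod_cast min_le_right r ℓ) (by exact_mod_cast min_le_left r ℓ)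
      (by positivity) (by positivity)
  rw [KK_split y hy c]
  refine (nrm_add _ _).trans ?_
  rw [Real.sqrt_mul (by positivity)] at hA hm
  have := mul_le_mul_of_nonneg_right hm (nrm_nonneg c)
  nlinarith

theorem KK_con (y : BV n) (c : FockV n) (ℓ r : ℕ) (hc : IsCon ℓ r c) : IsCon ℓ (r + 1) (KK y c) :=
  IsCon.sum _ _ fun x _ => hc.hop x (x + y)

/-- The normally ordered double hop in the position-like representation. -/
noncomputable def DD (y : BV n) (c : FockV n) : FockV n :=
  ∑ x, ∑ x', cre n (x + y) (cre n (x' + y) (ann n x (ann n x' c)))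

theorem num_con (c : FockV n) (ℓ r : ℕ) (hc : IsCon ℓ r c) :
    ∑ x, cre n x (ann n x c) = (ℓ : ℂ) • c := by
  ext u
  rw [Finsupp.finsetSum_apply]
  simp only [cre_ann_apply, Finsupp.smul_apply, smul_eq_mul]
  rw [← Finset.sum_mul]
  by_cases h : c u = 0
  · simp [h]
  · rw [← (hc u h).1]; push_cast; rfl

theorem KK_KK (y : BV n) (c : FockV n) (ℓ r : ℕ) (hc : IsCon ℓ r c) :
    KK y (KK y c) = DD y c + (ℓ : ℂ) • c := by
  rw [← num_con c ℓ r hc]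
  unfold KK DD
  simp only [map_sum, ccr, map_add, Finset.sum_add_distrib]
  refine congrArg₂ (· + ·) rfl ?_
  rw [Finset.sum_comm]
  refine Finset.sum_congr rfl fun x _ => ?_
  rw [Finset.sum_eq_single (x + y)]
  · rw [if_pos rfl, add_assoc, bv_add_self, add_zero]
  · intro b _ hb
    rw [if_neg hb, map_zero]
  · intro h; exact absurd (Finset.mem_univ _) h

theorem sHop_MM (ℓ : ℕ) (y : BV n) (c : FockV n) :
    sHop n ℓ y (MM n c) = MM n ((((Real.sqrt (ℓ : ℝ))⁻¹ : ℝ) : ℂ) • KK y c) := by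
  unfold sHop KK
  simp only [LinearMap.smul_apply, LinearMap.sum_apply, Module.End.mul_apply, map_smul, map_sum,
    MM_cre, MM_ann]

theorem dHop_MM (ℓ : ℕ) (y : BV n) (c : FockV n) :
    dHop n ℓ y (MM n c) = MM n (((ℓ : ℂ))⁻¹ • DD y c) := by
  unfold dHop DD
  simp only [LinearMap.smul_apply, LinearMap.sum_apply, Module.End.mul_apply, map_smul, map_sum,
    MM_cre, MM_ann]

theorem MM_nrm (c : FockV n) : nrm (MM n c) = nrm c := by
  unfold nrm; rw [MM_nsq]

theorem nsq_le_of_nrm {φ ψ : FockV n} {a : ℝ} (h : nrm φ ≤ a * nrm ψ) :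
    nsq n φ ≤ a ^ 2 * nsq n ψ := by
  rw [← nrm_sq, ← nrm_sq, ← mul_pow]
  exact pow_le_pow_left₀ (nrm_nonneg _) h 2

theorem num_bound (r : ℝ) (hr : 0 ≤ r) :
    (Real.sqrt (r + 1) + Real.sqrt (2 + 4 * (r + 1))) * (Real.sqrt r + Real.sqrt (2 + 4 * r)) + 1
      ≤ 9 * r + 9 := by
  have amgm : ∀ a b : ℝ, 0 ≤ a → 0 ≤ b → ∀ t : ℝ, 0 < t →
      Real.sqrt a * Real.sqrt b ≤ (t * a + b / t) / 2 := by
    intro a b ha hb t ht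
    have h1 := Real.sq_sqrt ha
    have h2 := Real.sq_sqrt hb
    have h3 : 0 ≤ (t * Real.sqrt a - Real.sqrt b) ^ 2 / t := by positivity
    have h4 : (t * Real.sqrt a - Real.sqrt b) ^ 2 / t =
        t * a + b / t - 2 * (Real.sqrt a * Real.sqrt b) := by
      rw [← h1, ← h2]
      simp only [Real.sqrt_sq (Real.sqrt_nonneg _)]
      field_simp
      ring
    linarith
  have h1 := amgm (r + 1) r (by positivity) hr 1 (by norm_num)
  have h2 := amgm (r + 1) (2 + 4 * r) (by positivity) (by positivity) 2 (by norm_num)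
  have h3 := amgm (2 + 4 * (r + 1)) r (by positivity) hr (1 / 2) (by norm_num)
  have h4 := amgm (2 + 4 * (r + 1)) (2 + 4 * r) (by positivity) (by positivity) 1 (by norm_num)
  nlinarith

end helpers

/-- norm of hopping operators on condensates.
For `y ≠ 0` and `r ≥ 0`, on the `ℓ`-boson space,
`‖G̃_y · Con_r‖ ≤ √r + √(2+4r)` and `‖H̃_y · Con_r‖ ≤ 9r + 9`. -/
theorem hop_norm_on_condensates (n ℓ : ℕ) (y : BV n) (hy : y ≠ 0) (r : ℕ) :
    (∀ ψ : FockV n,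
        nsq n ((sHop n ℓ y) ((conProj n ℓ r) ψ))
          ≤ (Real.sqrt (r : ℝ) + Real.sqrt (2 + 4 * (r : ℝ))) ^ 2 * nsq n ψ) ∧
    (∀ ψ : FockV n,
        nsq n ((dHop n ℓ y) ((conProj n ℓ r) ψ))
          ≤ (9 * (r : ℝ) + 9) ^ 2 * nsq n ψ) := by
  have case0 : ℓ = 0 ∨ 0 < (ℓ : ℝ) := by
    rcases Nat.eq_zero_or_pos ℓ with h | h
    · exact Or.inl h
    · exact Or.inr (by exact_mod_cast h)
  constructor
  · intro ψ
    obtain ⟨c, hc, hcψ, hn⟩ := conProj_spec ℓ r ψ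
    refine nsq_le_of_nrm ?_
    have hC : 0 ≤ Real.sqrt (r : ℝ) + Real.sqrt (2 + 4 * (r : ℝ)) := by positivity
    refine le_trans ?_ (mul_le_mul_of_nonneg_left hn hC)
    rw [hcψ, sHop_MM, MM_nrm, nrm_smul, Complex.norm_real, Real.norm_of_nonneg (by positivity)]
    rcases case0 with h0 | h0
    · subst h0
      simp only [Nat.cast_zero, Real.sqrt_zero, inv_zero, zero_mul]
      exact mul_nonneg hC (nrm_nonneg _)
    · have h := KK_nrm y hy c ℓ r hc
      have hs : 0 < Real.sqrt (ℓ : ℝ) := Real.sqrt_pos.mpr h0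
      rw [inv_mul_le_iff₀ hs, ← mul_assoc]
      exact h
  · intro ψ
    obtain ⟨c, hc, hcψ, hn⟩ := conProj_spec ℓ r ψ
    refine nsq_le_of_nrm ?_
    have hC : 0 ≤ 9 * (r : ℝ) + 9 := by positivity
    refine le_trans ?_ (mul_le_mul_of_nonneg_left hn hC)
    rw [hcψ, dHop_MM, MM_nrm, nrm_smul, norm_inv, Complex.norm_natCast]
    rcases case0 with h0 | h0
    · subst h0
      simp only [Nat.cast_zero, inv_zero, zero_mul]
      exact mul_nonneg hC (nrm_nonneg _)
    · rw [inv_mul_le_iff₀ h0]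
      have e : DD y c = KK y (KK y c) + (-(ℓ : ℂ)) • c := by
        rw [KK_KK y c ℓ r hc, neg_smul, add_neg_cancel_right]
      have h1 := KK_nrm y hy c ℓ r hc
      have h2 := KK_nrm y hy (KK y c) ℓ (r + 1) (KK_con y c ℓ r hc)
      have h3 : nrm (DD y c) ≤ nrm (KK y (KK y c)) + ℓ * nrm c := by
        rw [e]
        refine (nrm_add _ _).trans ?_
        rw [nrm_smul, norm_neg, Complex.norm_natCast]
      have h4 := num_bound r (by positivity)
      push_cast at h2
      have h5 := h2.trans (mul_le_mul_of_nonneg_left h1 (by positivity))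
      have h6 : Real.sqrt (ℓ : ℝ) * Real.sqrt ℓ = ℓ := Real.mul_self_sqrt h0.le
      have h7 := mul_le_mul_of_nonneg_left h4 (mul_nonneg h0.le (nrm_nonneg c))
      have h8 : nrm (KK y (KK y c)) ≤ ℓ * nrm c *
          ((Real.sqrt ((r : ℝ) + 1) + Real.sqrt (2 + 4 * ((r : ℝ) + 1))) *
            (Real.sqrt r + Real.sqrt (2 + 4 * r))) := by
        refine h5.trans (le_of_eq ?_)
        linear_combination (nrm c *
          ((Real.sqrt ((r : ℝ) + 1) + Real.sqrt (2 + 4 * ((r : ℝ) + 1))) *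
            (Real.sqrt r + Real.sqrt (2 + 4 * r)))) * h6
      nlinarith
end

section
/- Let n, ℓ, r, o ∈ ℕ. For every (r,o)-quasi-even condensate tuple u of ℓ bosons and every integer d ≥ 0, the number of (r,o)-quasi-even condensate tuples w with ∑_x |w_x − u_x| = 2d is at most (2^{n+1})^{d/2 + o} · (r + 1 + d/2 + o)^{d/2 + o}. -/
open scoped BigOperators

/-- `u` is an `(r,o)`-quasi-even condensate tuple of `ℓ` bosons:
`∑_x u_x = ℓ`, `u_{0^n} ≥ ℓ − r`, and at most `o` modes `x ≠ 0^n` have `u_x` odd. -/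
def IsQECTuple (n ℓ r o : ℕ) (u : OccT n) : Prop :=
  (∑ x, u x) = ℓ ∧ ℓ - r ≤ u 0 ∧ oddCount n u ≤ o

/-- Functions supported in `T` with total at most `k`. -/
def boundedFuns {α : Type*} [Fintype α] (T : Finset α) (k : ℕ) : Set (α → ℕ) :=
  {f | (∀ a, f a ≠ 0 → a ∈ T) ∧ ∑ a, f a ≤ k}

lemma boundedFuns_count {α : Type*} [Fintype α] [DecidableEq α] (T : Finset α) (k : ℕ) :
    ∃ F : Finset (α → ℕ), boundedFuns T k ⊆ ↑F ∧ F.card ≤ (T.card + 1) ^ k := by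
  induction k with
  | zero =>
    refine ⟨{0}, ?_, by simp⟩
    rintro f ⟨-, hf⟩
    have : f = 0 := by
      funext a
      have := Finset.single_le_sum (f := f) (fun _ _ => Nat.zero_le _) (Finset.mem_univ a)
      simp only [Pi.zero_apply]
      omega
    simp [this]
  | succ k ih =>
    obtain ⟨F, hF, hc⟩ := ih
    refine ⟨F ∪ (F ×ˢ T).image (fun q => q.1 + Pi.single q.2 1), ?_, ?_⟩
    · rintro f ⟨hs, hf⟩
      by_cases h0 : ∑ a, f a ≤ k
      · have := hF (show f ∈ boundedFuns T k from ⟨hs, h0⟩)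
        simp only [Finset.coe_union, Set.mem_union]
        exact Or.inl this
      · obtain ⟨a, -, ha⟩ : ∃ a ∈ Finset.univ, f a ≠ 0 := by
          apply Finset.exists_ne_zero_of_sum_ne_zero
          omega
        have hfe : (f - Pi.single a 1) + Pi.single a 1 = f := by
          funext b
          by_cases hb : b = a
          · subst hb; simp; omega
          · simp [hb]
        have hsum : ∑ b, (f - Pi.single a 1 : α → ℕ) b + 1 = ∑ b, f b := by
          conv_rhs => rw [← hfe]
          simp only [Pi.add_apply, Finset.sum_add_distrib]
          simp
        have hmem : (f - Pi.single a 1 : α → ℕ) ∈ boundedFuns T k := by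
          refine ⟨fun b hb => hs b ?_, by omega⟩
          simp only [Pi.sub_apply] at hb
          omega
        have h2 := hF hmem
        simp only [Finset.coe_union, Set.mem_union]
        right
        simp only [Finset.coe_image, Set.mem_image]
        exact ⟨(f - Pi.single a 1, a), by simpa using ⟨h2, hs a ha⟩, hfe⟩
    · calc _ ≤ F.card + (F ×ˢ T).card :=
            (Finset.card_union_le _ _).trans (Nat.add_le_add_left Finset.card_image_le _)
        _ = F.card * (T.card + 1) := by rw [Finset.card_product]; ring
        _ ≤ _ := by rw [pow_succ]; exact Nat.mul_le_mul_right _ hc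

/-- Encode a function off zero by parities and halves. -/
def encPH {n : ℕ} (p : OccT n) : BV n × Bool → ℕ := fun q =>
  if q.1 = 0 then 0 else if q.2 then p q.1 % 2 else p q.1 / 2

lemma encPH_inj {n : ℕ} {p p' : OccT n} (h : encPH p = encPH p') (x : BV n) (hx : x ≠ 0) :
    p x = p' x := by
  have h1 := congrFun h (x, true)
  have h2 := congrFun h (x, false)
  simp [encPH, hx] at h1 h2
  omega

lemma encPH_sum {n : ℕ} (p : OccT n) (d o : ℕ) (hp : ∑ x, p x ≤ d)
    (ho : oddCount n p ≤ 2 * o) : ∑ q, encPH p q ≤ (d + 2 * o) / 2 := by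
  have h : 2 * ∑ q, encPH p q ≤ ∑ x, p x + oddCount n p := by
    rw [oddCount, Finset.card_filter, ← Finset.sum_add_distrib, Fintype.sum_prod_type,
      Finset.mul_sum]
    apply Finset.sum_le_sum
    intro x _
    by_cases hx : x = 0
    · simp [encPH, hx]
    · simp only [Fintype.sum_bool, encPH, hx, Nat.odd_iff, if_false, if_true,
        ne_eq, not_false_eq_true, true_and, Bool.false_eq_true]
      split_ifs <;> omega
  omega

lemma oddCount_diff {n : ℕ} (p u w : OccT n) (o : ℕ) (hu : oddCount n u ≤ o)
    (hw : oddCount n w ≤ o) (h : ∀ x, Odd (p x) → Odd (u x) ∨ Odd (w x)) :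
    oddCount n p ≤ 2 * o := by
  have : oddCount n p ≤ oddCount n u + oddCount n w := by
    unfold oddCount
    refine (Finset.card_le_card ?_).trans (Finset.card_union_le _ _)
    intro x hx
    simp only [Finset.mem_filter, Finset.mem_union, Finset.mem_univ, true_and] at hx ⊢
    rcases h x hx.2 with h | h
    · exact Or.inl ⟨hx.1, h⟩
    · exact Or.inr ⟨hx.1, h⟩
  omega

lemma count_nat (n ℓ r o : ℕ) (u : OccT n) (hu : IsQECTuple n ℓ r o u) (d : ℕ) :
    Set.ncard {w : OccT n | IsQECTuple n ℓ r o w ∧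
        (∑ x, ((w x : ℤ) - (u x : ℤ)).natAbs) = 2 * d}
      ≤ (2 ^ (n + 1)) ^ ((d + 2 * o) / 2) * (r + 1) ^ ((d + 2 * o) / 2) := by
  classical
  set k := (d + 2 * o) / 2 with hk
  let T₁ : Finset (BV n × Bool) := Finset.univ.filter fun q => q.1 ≠ 0
  let T₂ : Finset (BV n × Bool) := Finset.univ.filter fun q =>
    q.1 ≠ 0 ∧ (if q.2 then 1 ≤ u q.1 else 2 ≤ u q.1)
  have hT₁ : T₁.card + 1 ≤ 2 ^ (n + 1) := by
    have : T₁.card < (Finset.univ : Finset (BV n × Bool)).card := by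
      apply Finset.card_lt_card
      rw [Finset.ssubset_univ_iff]
      intro h
      have : ((0 : BV n), true) ∈ T₁ := by rw [h]; simp
      simp [T₁] at this
    simp [Finset.card_univ, ZMod.card] at this
    rw [pow_succ]
    omega
  have hT₂ : T₂.card ≤ r := by
    have h1 : T₂.card ≤ ∑ x ∈ Finset.univ.erase (0 : BV n), u x := by
      rw [Finset.card_filter, Fintype.sum_prod_type,
        ← Finset.add_sum_erase _ _ (Finset.mem_univ (0 : BV n))]
      simp only [ne_eq, not_true_eq_false, false_and, if_false, Finset.sum_const_zero, zero_add]
      apply Finset.sum_le_sum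
      intro x hx
      have hx := Finset.ne_of_mem_erase hx
      simp only [Fintype.sum_bool, hx, not_false_eq_true, true_and, if_true, if_false,
        Bool.false_eq_true]
      split_ifs <;> omega
    have h2 := Finset.add_sum_erase Finset.univ u (Finset.mem_univ (0 : BV n))
    obtain ⟨a, b, c⟩ := hu
    omega
  obtain ⟨F₁, hF₁, hc₁⟩ := boundedFuns_count T₁ k
  obtain ⟨F₂, hF₂, hc₂⟩ := boundedFuns_count T₂ k
  have key : Set.ncard {w : OccT n | IsQECTuple n ℓ r o w ∧
        (∑ x, ((w x : ℤ) - (u x : ℤ)).natAbs) = 2 * d} ≤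
        Set.ncard (↑(F₁ ×ˢ F₂) : Set ((BV n × Bool → ℕ) × (BV n × Bool → ℕ))) := by
    apply Set.ncard_le_ncard_of_injOn
      (fun w => (encPH (fun x => w x - u x), encPH (fun x => u x - w x)))
    · rintro w ⟨hw, hd⟩
      have e1 : ∑ x, (w x - u x) + ∑ x, (u x - w x) = 2 * d := by
        rw [← hd, ← Finset.sum_add_distrib]
        apply Finset.sum_congr rfl
        intro x _
        omega
      have e2 : ∑ x, w x + ∑ x, (u x - w x) = ∑ x, u x + ∑ x, (w x - u x) := by
        rw [← Finset.sum_add_distrib, ← Finset.sum_add_distrib]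
        apply Finset.sum_congr rfl
        intro x _
        omega
      rw [hw.1, hu.1] at e2
      rw [Finset.coe_product]
      refine ⟨hF₁ ⟨?_, ?_⟩, hF₂ ⟨?_, ?_⟩⟩
      · rintro ⟨x, b⟩ h
        simp only [T₁, Finset.mem_filter, Finset.mem_univ, true_and]
        intro hx
        exact h (by simp [encPH, hx])
      · refine encPH_sum (fun x => w x - u x) d o (by omega) ?_
        apply oddCount_diff _ u w o hu.2.2 hw.2.2
        intro x
        simp only [Nat.odd_iff]
        omega
      · rintro ⟨x, b⟩ h
        simp only [T₂, Finset.mem_filter, Finset.mem_univ, true_and]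
        by_cases hx : x = 0
        · exact absurd (by simp [encPH, hx]) h
        · refine ⟨hx, ?_⟩
          cases b <;> simp [encPH, hx] at h ⊢ <;> omega
      · refine encPH_sum (fun x => u x - w x) d o (by omega) ?_
        apply oddCount_diff _ u w o hu.2.2 hw.2.2
        intro x
        simp only [Nat.odd_iff]
        omega
    · rintro w ⟨hw, -⟩ w' ⟨hw', -⟩ h
      simp only [Prod.mk.injEq] at h
      have hne : ∀ x, x ≠ 0 → w x = w' x := by
        intro x hx
        have h1 := encPH_inj h.1 x hx
        have h2 := encPH_inj h.2 x hx
        omega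
      funext x
      by_cases hx : x = 0
      · subst hx
        have h1 := Finset.add_sum_erase Finset.univ w (Finset.mem_univ (0 : BV n))
        have h2 := Finset.add_sum_erase Finset.univ w' (Finset.mem_univ (0 : BV n))
        have h3 : ∑ x ∈ Finset.univ.erase (0 : BV n), w x
            = ∑ x ∈ Finset.univ.erase (0 : BV n), w' x :=
          Finset.sum_congr rfl fun x hx => hne x (Finset.ne_of_mem_erase hx)
        rw [hw.1] at h1
        rw [hw'.1] at h2
        omega
      · exact hne x hx
  rw [Set.ncard_coe_finset, Finset.card_product] at key
  refine key.trans (Nat.mul_le_mul (hc₁.trans ?_) (hc₂.trans ?_))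
  · exact Nat.pow_le_pow_left hT₁ _
  · exact Nat.pow_le_pow_left (by omega) _

/-- counting quasi-even condensates at a fixed distance.
For every `(r,o)`-quasi-even condensate tuple `u` of `ℓ` bosons and every `d ≥ 0`, the
number of `(r,o)`-quasi-even condensate tuples `w` with `∑_x |w_x − u_x| = 2d` is at most
`(2^{n+1})^{d/2+o} · (r + 1 + d/2 + o)^{d/2+o}` (real exponents). -/
theorem count_qec_at_distance (n ℓ r o : ℕ) (u : OccT n) (hu : IsQECTuple n ℓ r o u)
    (d : ℕ) :
    (Set.ncard {w : OccT n | IsQECTuple n ℓ r o w ∧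
        (∑ x, ((w x : ℤ) - (u x : ℤ)).natAbs) = 2 * d} : ℝ)
      ≤ ((2 : ℝ) ^ (n + 1)) ^ ((d : ℝ) / 2 + (o : ℝ))
          * ((r : ℝ) + 1 + (d : ℝ) / 2 + (o : ℝ)) ^ ((d : ℝ) / 2 + (o : ℝ)) := by
  have h := count_nat n ℓ r o u hu d
  set k := (d + 2 * o) / 2 with hk
  have hk' : (k : ℝ) ≤ (d : ℝ) / 2 + (o : ℝ) := by
    have : 2 * k ≤ d + 2 * o := by omega
    have : (2 : ℝ) * k ≤ d + 2 * o := by exact_mod_cast this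
    linarith
  have h' := (Nat.cast_le (α := ℝ)).2 h
  push_cast at h'
  refine h'.trans ?_
  have hd : (0 : ℝ) ≤ d := Nat.cast_nonneg d
  have ho : (0 : ℝ) ≤ o := Nat.cast_nonneg o
  have hr : (0 : ℝ) ≤ r := Nat.cast_nonneg r
  apply mul_le_mul _ _ (by positivity) (by positivity)
  · rw [← Real.rpow_natCast ((2 : ℝ) ^ (n + 1)) k]
    exact Real.rpow_le_rpow_of_exponent_le (one_le_pow₀ (by norm_num)) hk'
  · calc ((r : ℝ) + 1) ^ k ≤ ((r : ℝ) + 1 + (d : ℝ) / 2 + (o : ℝ)) ^ k :=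
          pow_le_pow_left₀ (by positivity) (by linarith) _
      _ ≤ _ := by
        rw [← Real.rpow_natCast]
        exact Real.rpow_le_rpow_of_exponent_le (by linarith) hk'
end

section
/- Fix n, ℓ, R ∈ ℕ and y ∈ {0,1}^n with y ≠ 0^n. For x, x' ∈ {0,1}^n let Δ^{(y)}_{x,x'} = 1_{x⊕y} + 1_{x'⊕y} − 1_x − 1_{x'} ∈ ℤ^{2^n}, where 1_z is the indicator tuple of z and ⊕ is bitwise XOR. Then for every R-condensate tuple u (an occupation tuple with ∑_x u_x = ℓ and u_{0^n} ≥ ℓ − R), the set { v ∈ ℕ^{2^n} : ∃ x, x' ∈ {0,1}^n with x ∉ {x', x'⊕y} and u = v + Δ^{(y)}_{x,x'} } has cardinality at most (R+1)². -/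
open scoped BigOperators

/-- The tuple `Δ^{(y)}_{x,x'} = 1_{x⊕y} + 1_{x'⊕y} − 1_x − 1_{x'} ∈ ℤ^{2^n}`. -/
noncomputable def doubleDiff {n : ℕ} (y x x' : BV n) (z : BV n) : ℤ :=
  (if z = x + y then 1 else 0) + (if z = x' + y then 1 else 0)
    - (if z = x then 1 else 0) - (if z = x' then 1 else 0)

/-- size of the double-difference set.
For every `R`-condensate tuple `u` (i.e. `∑_x u_x = ℓ` and `u_{0^n} ≥ ℓ − R`) and every
`y ≠ 0^n`, the set `{v ∈ ℕ^{2^n} : ∃ x, x' with x ∉ {x', x'⊕y} and u = v + Δ^{(y)}_{x,x'}}`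
has cardinality at most `(R+1)²`. -/
theorem double_diff_set_card (n ℓ R : ℕ) (y : BV n) (hy : y ≠ 0)
    (u : BV n → ℕ) (hsum : (∑ x, u x) = ℓ) (hcon : ℓ - R ≤ u 0) :
    Set.ncard {v : BV n → ℕ | ∃ x x' : BV n, x ≠ x' ∧ x ≠ x' + y ∧
        ∀ z : BV n, (u z : ℤ) = (v z : ℤ) + doubleDiff y x x' z}
      ≤ (R + 1) ^ 2 := by
  classical
  set S : Finset (BV n) := Finset.univ.filter (fun z => u z ≠ 0) with hS
  have hyy : y + y = 0 := by
    funext i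
    exact CharTwo.add_self_eq_zero (y i)
  have hcancel : ∀ x : BV n, x + y + y = x := fun x => by rw [add_assoc, hyy, add_zero]
  have hcard : S.card ≤ R + 1 := by
    have h1 : (S.erase 0).card ≤ ∑ x ∈ S.erase 0, u x := by
      rw [Finset.card_eq_sum_ones]
      apply Finset.sum_le_sum
      intro z hz
      have hz2 := (Finset.mem_filter.mp (Finset.mem_of_mem_erase hz)).2
      omega
    have h2 : ∑ x ∈ S.erase 0, u x ≤ ∑ x ∈ Finset.univ.erase (0 : BV n), u x :=
      Finset.sum_le_sum_of_subset (Finset.erase_subset_erase _ (Finset.subset_univ _))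
    have h3 := Finset.add_sum_erase Finset.univ u (Finset.mem_univ (0 : BV n))
    have h4 := Finset.pred_card_le_card_erase (s := S) (a := 0)
    omega
  let f : BV n × BV n → (BV n → ℕ) := fun p z =>
    ((u z : ℤ) - doubleDiff y (p.1 + y) (p.2 + y) z).toNat
  have hsub : {v : BV n → ℕ | ∃ x x' : BV n, x ≠ x' ∧ x ≠ x' + y ∧
        ∀ z : BV n, (u z : ℤ) = (v z : ℤ) + doubleDiff y x x' z}
      ⊆ (((S ×ˢ S).image f : Finset (BV n → ℕ)) : Set (BV n → ℕ)) := by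
    rintro v ⟨x, x', hne, hne', h⟩
    have a1 : x + y ≠ x := fun e => hy (by simpa using e)
    have a2 : x' + y ≠ x' := fun e => hy (by simpa using e)
    have a3 : x + y ≠ x' := fun e => hne' (by rw [← e, hcancel])
    have a4 : x' + y ≠ x := fun e => hne' e.symm
    have a5 : x + y ≠ x' + y := fun e => hne (add_right_cancel e)
    rw [Finset.mem_coe, Finset.mem_image]
    refine ⟨(x + y, x' + y), ?_, ?_⟩
    · rw [Finset.mem_product]
      refine ⟨Finset.mem_filter.mpr ⟨Finset.mem_univ _, ?_⟩,
        Finset.mem_filter.mpr ⟨Finset.mem_univ _, ?_⟩⟩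
      · have hz := h (x + y)
        rw [doubleDiff, if_pos rfl, if_neg a5, if_neg a1, if_neg a3] at hz
        show u (x + y) ≠ 0
        omega
      · have hz := h (x' + y)
        rw [doubleDiff, if_neg a5.symm, if_pos rfl, if_neg a4, if_neg a2] at hz
        show u (x' + y) ≠ 0
        omega
    · funext z
      have hz := h z
      show ((u z : ℤ) - doubleDiff y (x + y + y) (x' + y + y) z).toNat = v z
      rw [hcancel, hcancel]
      omega
  calc _ ≤ Set.ncard (((S ×ˢ S).image f : Finset (BV n → ℕ)) : Set (BV n → ℕ)) :=
        Set.ncard_le_ncard hsub (Finset.finite_toSet _)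
    _ = ((S ×ˢ S).image f).card := Set.ncard_coe_finset _
    _ ≤ (S ×ˢ S).card := Finset.card_image_le
    _ = S.card ^ 2 := by rw [Finset.card_product, sq]
    _ ≤ (R + 1) ^ 2 := Nat.pow_le_pow_left hcard 2
end

section
/- For all integers R with 16 ≤ R ≤ ℓ and all y ∈ {0,1}^n with y ≠ 0^n, the following operator-norm bound holds on the ℓ-boson space: ‖ ∑_{o=0}^{R} (id − QE_{=o}) · H̃_y · QEC_{(R,=o)} ‖_op ≤ R⁵ / √ℓ. -/
open scoped BigOperators

namespace DHQ

lemma ann_single (n : ℕ) (x : BV n) (u : OccT n) (a : ℂ) :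
    ann n x (Finsupp.single u a) =
      (a * ((Real.sqrt (u x) : ℝ) : ℂ)) • Finsupp.single (Function.update u x (u x - 1)) 1 := by
  simp [ann]

lemma cre_single (n : ℕ) (x : BV n) (u : OccT n) (a : ℂ) :
    cre n x (Finsupp.single u a) =
      (a * ((Real.sqrt (u x + 1) : ℝ) : ℂ)) •
        Finsupp.single (Function.update u x (u x + 1)) 1 := by
  simp [cre]

lemma cre_comm (n : ℕ) (x z : BV n) : cre n x * cre n z = cre n z * cre n x := by
  by_cases h : x = z
  · rw [h]
  refine Finsupp.lhom_ext fun u a => ?_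
  simp only [Module.End.mul_apply, cre_single, map_smul, smul_smul]
  rw [Function.update_of_ne h, Function.update_of_ne (Ne.symm h), Function.update_comm h]
  congr 1
  ring

lemma ccr (n : ℕ) (x z : BV n) :
    ann n x * cre n z = cre n z * ann n x + (if x = z then 1 else 0) := by
  by_cases h : x = z
  · subst h
    refine Finsupp.lhom_ext fun u a => ?_
    simp only [Module.End.mul_apply, cre_single, ann_single, map_smul, smul_smul, if_true,
      LinearMap.add_apply, Module.End.one_apply, Function.update_self, Function.update_idem]
    rw [show u x + 1 - 1 = u x from rfl, Function.update_eq_self]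
    rcases Nat.eq_zero_or_pos (u x) with h0 | h0
    · simp [h0]
    · rw [Nat.sub_add_cancel h0, Function.update_eq_self]
      have e1 : ((u x - 1 : ℕ) : ℝ) + 1 = u x := by
        rw [Nat.cast_sub h0]; simp
      rw [e1]
      have h1 : ((Real.sqrt (u x) : ℝ) : ℂ) * ((Real.sqrt (u x) : ℝ) : ℂ) = (u x : ℂ) := by
        rw [← Complex.ofReal_mul, Real.mul_self_sqrt (by positivity)]; simp
      have h2 : ((Real.sqrt (u x + 1) : ℝ) : ℂ) * ((Real.sqrt (u x + 1) : ℝ) : ℂ)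
          = (u x + 1 : ℂ) := by
        rw [← Complex.ofReal_mul, Real.mul_self_sqrt (by positivity)]; simp
      simp only [one_mul, mul_assoc, Nat.cast_add, Nat.cast_one, h1, h2]
      simp only [Finsupp.smul_single, smul_eq_mul, mul_one]
      rw [← Finsupp.single_add]
      congr 1
      ring
  · refine Finsupp.lhom_ext fun u a => ?_
    simp only [Module.End.mul_apply, cre_single, ann_single, map_smul, smul_smul, if_neg h,
      add_zero]
    rw [Function.update_of_ne h, Function.update_of_ne (Ne.symm h), Function.update_comm h]
    congr 1
    ring

/-! Characters -/

lemma zmod2_ne (a : ZMod 2) : a ≠ 0 → a = 1 := by revert a; decide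

lemma chiR_mul {n : ℕ} (p x z : BV n) : chiR p x * chiR p z = chiR p (x + z) := by
  have : (∑ j, p j * (x + z) j : ZMod 2) = (∑ j, p j * x j) + ∑ j, p j * z j := by
    rw [← Finset.sum_add_distrib]
    exact Finset.sum_congr rfl fun j _ => by simp [mul_add]
  unfold chiR
  rw [this]
  generalize (∑ j, p j * x j : ZMod 2) = a
  generalize (∑ j, p j * z j : ZMod 2) = b
  by_cases ha : a = 0
  · simp [ha]
  · by_cases hb : b = 0
    · simp [hb]
    · have := zmod2_ne a ha
      have := zmod2_ne b hb
      subst a b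
      have : (1 + 1 : ZMod 2) = 0 := by decide
      simp [this]

lemma chiR_shift {n : ℕ} (p s : BV n) (j : Fin n) (hj : s j ≠ 0) :
    chiR (p + Pi.single j 1) s = - chiR p s := by
  have hj := zmod2_ne _ hj
  have : (∑ i, (p + Pi.single j 1 : BV n) i * s i : ZMod 2) = (∑ i, p i * s i) + 1 := by
    simp only [Pi.add_apply, add_mul, Finset.sum_add_distrib]
    congr 1
    rw [Finset.sum_eq_single j] <;> simp +contextual [hj]
  unfold chiR
  rw [this]
  generalize (∑ j, p j * s j : ZMod 2) = a
  by_cases ha : a = 0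
  · simp [ha]
  · have := zmod2_ne a ha
    subst a
    have : (1 + 1 : ZMod 2) = 0 := by decide
    simp [this]

lemma add_eq_zero_iff' {n : ℕ} (x z : BV n) : x + z = 0 ↔ x = z := by
  have h : z + z = 0 := by
    funext i
    have : ∀ a : ZMod 2, a + a = 0 := by decide
    exact this _
  constructor
  · intro h'
    have := congrArg (· + z) h'
    simpa [add_assoc, h] using this
  · rintro rfl; exact h

lemma chiR_sum {n : ℕ} (x z : BV n) :
    ∑ p : BV n, chiR p x * chiR p z = if x = z then (2 : ℝ) ^ n else 0 := by
  simp only [chiR_mul]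
  split_ifs with h
  · rw [(add_eq_zero_iff' x z).2 h]
    simp [chiR, ZMod.card]
  · have hs : x + z ≠ 0 := fun h' => h ((add_eq_zero_iff' x z).1 h')
    obtain ⟨j, hj⟩ := Function.ne_iff.1 hs
    have h1 := Equiv.sum_comp (Equiv.addRight (Pi.single j 1 : BV n)) (fun p => chiR p (x + z))
    simp only [Equiv.coe_addRight, chiR_shift _ _ j hj, Finset.sum_neg_distrib] at h1
    linarith

lemma mcre_comm (n : ℕ) (x z : BV n) : mcre n x * mcre n z = mcre n z * mcre n x := by
  have key : ∀ (c d : ℂ) (f g : BV n → ℂ),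
      (c • ∑ p : BV n, f p • cre n p) * (d • ∑ q : BV n, g q • cre n q)
      = (d • ∑ q : BV n, g q • cre n q) * (c • ∑ p : BV n, f p • cre n p) := by
    intro c d f g
    have : Commute (∑ p : BV n, f p • cre n p) (∑ q : BV n, g q • cre n q) := by
      refine Commute.sum_left _ _ _ fun p _ => Commute.sum_right _ _ _ fun q _ => ?_
      exact ((show Commute (cre n p) (cre n q) from cre_comm n p q).smul_left _).smul_right _
    exact (this.smul_left c).smul_right d
  exact key _ _ _ _

lemma mccr (n : ℕ) (x z : BV n) :
    mann n x * mcre n z = mcre n z * mann n x + (if x = z then 1 else 0) := by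
  have h1 : (∑ p : BV n, ((chiR p x : ℝ) : ℂ) • ann n p) *
      (∑ q : BV n, ((chiR q z : ℝ) : ℂ) • cre n q) =
      (∑ q : BV n, ((chiR q z : ℝ) : ℂ) • cre n q) *
      (∑ p : BV n, ((chiR p x : ℝ) : ℂ) • ann n p)
      + (((∑ p : BV n, chiR p x * chiR p z : ℝ)) : ℂ) • (1 : FockOp n) := by
    rw [Finset.sum_mul_sum, Finset.sum_mul_sum, Finset.sum_comm (s := Finset.univ)
      (f := fun i j => (((chiR i z : ℝ) : ℂ) • cre n i) * (((chiR j x : ℝ) : ℂ) • ann n j))]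
    push_cast
    rw [Finset.sum_smul, ← Finset.sum_add_distrib]
    refine Finset.sum_congr rfl fun p _ => ?_
    have : ∀ q : BV n, (((chiR p x : ℝ) : ℂ) • ann n p) * (((chiR q z : ℝ) : ℂ) • cre n q)
      = (((chiR q z : ℝ) : ℂ) • cre n q) * (((chiR p x : ℝ) : ℂ) • ann n p)
        + (if p = q then (((chiR p x : ℝ) : ℂ) * ((chiR q z : ℝ) : ℂ)) • (1 : FockOp n) else 0) := by
      intro q
      rw [smul_mul_smul_comm, smul_mul_smul_comm, ccr, smul_add, mul_comm (((chiR q z : ℝ) : ℂ))]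
      split_ifs <;> simp
    simp only [this, Finset.sum_add_distrib, Finset.sum_ite_eq, Finset.mem_univ, if_true]
  unfold mann mcre
  rw [smul_mul_smul_comm, smul_mul_smul_comm, h1, smul_add, smul_smul, chiR_sum]
  congr 1
  have h2 : ((Real.sqrt ((2 : ℝ) ^ n))⁻¹ : ℝ) * (Real.sqrt ((2 : ℝ) ^ n))⁻¹ * (2 : ℝ) ^ n = 1 := by
    rw [← mul_inv, Real.mul_self_sqrt (by positivity)]
    exact inv_mul_cancel₀ (by positivity)
  rw [← Complex.ofReal_mul, ← Complex.ofReal_mul]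
  split_ifs
  · rw [h2]; simp
  · simp

lemma mann_vac (n : ℕ) (x : BV n) : mann n x (vac n) = 0 := by
  simp [mann, vac, ann_single, LinearMap.sum_apply]

/-! Inner product -/

lemma finner_single_left (n : ℕ) (u : OccT n) (a : ℂ) (ψ : FockV n) :
    finner n (Finsupp.single u a) ψ = (starRingEnd ℂ) a * ψ u := by
  simp [finner]

lemma finner_add_left (n : ℕ) (φ φ' ψ : FockV n) :
    finner n (φ + φ') ψ = finner n φ ψ + finner n φ' ψ := by
  unfold finner
  rw [Finsupp.sum_add_index'] <;> simp [add_mul]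

lemma finner_zero_left (n : ℕ) (ψ : FockV n) : finner n 0 ψ = 0 := by simp [finner]

lemma finner_add_right (n : ℕ) (φ ψ ψ' : FockV n) :
    finner n φ (ψ + ψ') = finner n φ ψ + finner n φ ψ' := by
  simp [finner, mul_add, Finsupp.sum_add]

lemma finner_smul_right (n : ℕ) (φ ψ : FockV n) (c : ℂ) :
    finner n φ (c • ψ) = c * finner n φ ψ := by
  simp only [finner, Finsupp.smul_apply, smul_eq_mul, Finsupp.sum, Finset.mul_sum]
  exact Finset.sum_congr rfl fun _ _ => by ring

lemma finner_zero_right (n : ℕ) (φ : FockV n) : finner n φ 0 = 0 := by simp [finner]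

/-- Linear functional version. -/
noncomputable def fl (n : ℕ) (φ : FockV n) : FockV n →ₗ[ℂ] ℂ where
  toFun := finner n φ
  map_add' := finner_add_right n φ
  map_smul' c ψ := finner_smul_right n φ ψ c

lemma fl_apply (n : ℕ) (φ ψ : FockV n) : fl n φ ψ = finner n φ ψ := rfl

lemma finner_conj (n : ℕ) (φ ψ : FockV n) :
    (starRingEnd ℂ) (finner n φ ψ) = finner n ψ φ := by
  induction φ using Finsupp.induction_linear with
  | zero => simp [finner_zero_left, finner_zero_right]
  | add f g hf hg => rw [finner_add_left, finner_add_right, map_add, hf, hg]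
  | single u a =>
    rw [finner_single_left]
    induction ψ using Finsupp.induction_linear with
    | zero => simp [finner_zero_left]
    | add f g hf hg => rw [finner_add_left, ← hf, ← hg]; simp [mul_add]
    | single w b =>
      rw [finner_single_left]
      by_cases h : w = u
      · subst h; simp [mul_comm]
      · rw [Finsupp.single_eq_of_ne (Ne.symm h), Finsupp.single_eq_of_ne h]; simp

lemma finner_smul_left (n : ℕ) (φ ψ : FockV n) (c : ℂ) :
    finner n (c • φ) ψ = (starRingEnd ℂ) c * finner n φ ψ := by
  rw [← finner_conj, finner_smul_right, map_mul, finner_conj]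

lemma finner_sum_right {ι : Type*} (n : ℕ) (s : Finset ι) (φ : FockV n) (f : ι → FockV n) :
    finner n φ (∑ i ∈ s, f i) = ∑ i ∈ s, finner n φ (f i) := by
  rw [← fl_apply, map_sum]; rfl

lemma finner_sum_left {ι : Type*} (n : ℕ) (s : Finset ι) (φ : FockV n) (f : ι → FockV n) :
    finner n (∑ i ∈ s, f i) φ = ∑ i ∈ s, finner n (f i) φ := by
  rw [← finner_conj, finner_sum_right, map_sum]
  exact Finset.sum_congr rfl fun _ _ => finner_conj _ _ _

lemma finner_self (n : ℕ) (ψ : FockV n) : finner n ψ ψ = ((nsq n ψ : ℝ) : ℂ) := by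
  simp only [finner, nsq, Finsupp.sum]
  push_cast
  exact Finset.sum_congr rfl fun _ _ => by rw [Complex.normSq_eq_conj_mul_self]

lemma nsq_nonneg (n : ℕ) (ψ : FockV n) : 0 ≤ nsq n ψ :=
  Finset.sum_nonneg fun _ _ => Complex.normSq_nonneg _

lemma cre_adj (n : ℕ) (x : BV n) (φ ψ : FockV n) :
    finner n (cre n x φ) ψ = finner n φ (ann n x ψ) := by
  induction φ using Finsupp.induction_linear with
  | zero => simp [finner_zero_left]
  | add f g hf hg => rw [map_add, finner_add_left, finner_add_left, hf, hg]
  | single u a =>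
    induction ψ using Finsupp.induction_linear with
    | zero => simp [finner_zero_right]
    | add f g hf hg => rw [map_add, finner_add_right, finner_add_right, hf, hg]
    | single w b =>
      rw [cre_single, ann_single, finner_smul_left, finner_smul_right, finner_single_left,
        finner_single_left]
      by_cases h : w = Function.update u x (u x + 1)
      · subst h
        simp
        ring
      · rw [Finsupp.single_eq_of_ne (Ne.symm h)]
        by_cases h' : u = Function.update w x (w x - 1)
        · rcases Nat.eq_zero_or_pos (w x) with h0 | h0
          · simp [h0]
          · exfalso
            apply h
            rw [h', Function.update_self, Function.update_idem, Nat.sub_add_cancel h0,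
              Function.update_eq_self]
        · rw [Finsupp.single_eq_of_ne h']
          simp

lemma mcre_adj (n : ℕ) (x : BV n) (φ ψ : FockV n) :
    finner n (mcre n x φ) ψ = finner n φ (mann n x ψ) := by
  simp only [mcre, mann, LinearMap.smul_apply, LinearMap.sum_apply, finner_smul_left,
    finner_smul_right, finner_sum_left, finner_sum_right, cre_adj, Complex.conj_ofReal]

/-! Momentum Fock states -/

/-- list product -/
noncomputable def LP (n : ℕ) (L : List (BV n)) (u : OccT n) : FockOp n :=
  (L.map fun x => (mcre n x) ^ (u x)).prod

lemma LP_comm (n : ℕ) (L : List (BV n)) (u : OccT n) (z : BV n) :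
    mcre n z * LP n L u = LP n L u * mcre n z := by
  refine Commute.list_prod_right _ _ fun a ha => ?_
  obtain ⟨x, _, rfl⟩ := List.mem_map.1 ha
  exact (show Commute (mcre n z) (mcre n x) from mcre_comm n z x).pow_right _

lemma LP_notMem (n : ℕ) (L : List (BV n)) (u : OccT n) (z : BV n) (k : ℕ) (hz : z ∉ L) :
    LP n L (Function.update u z k) = LP n L u := by
  unfold LP
  congr 1
  refine List.map_congr_left fun x hx => ?_
  rw [Function.update_of_ne]
  rintro rfl
  exact hz hx

lemma LP_succ (n : ℕ) (L : List (BV n)) (u : OccT n) (z : BV n) (hL : L.Nodup) (hz : z ∈ L) :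
    LP n L (Function.update u z (u z + 1)) = mcre n z * LP n L u := by
  induction L with
  | nil => simp at hz
  | cons a L ih =>
    have hc : ∀ v, LP n (a :: L) v = mcre n a ^ v a * LP n L v := fun v => by simp [LP]
    rw [hc, hc]
    rw [List.nodup_cons] at hL
    by_cases h : z = a
    · subst h
      rw [LP_notMem n L u z _ hL.1, Function.update_self, pow_succ', mul_assoc]
    · have hz' : z ∈ L := by simpa [h] using hz
      rw [ih hL.2 hz', Function.update_of_ne (Ne.symm h), ← mul_assoc, ← mul_assoc]
      congr 1
      exact ((show Commute (mcre n z) (mcre n a) from mcre_comm n z a).pow_right _).symm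

/-- Unnormalized momentum state. -/
noncomputable def QS (n : ℕ) (u : OccT n) : FockV n :=
  LP n (Finset.univ.toList (α := BV n)) u (vac n)

lemma QS_succ (n : ℕ) (u : OccT n) (z : BV n) :
    QS n (Function.update u z (u z + 1)) = mcre n z (QS n u) := by
  unfold QS
  rw [LP_succ n _ u z (Finset.nodup_toList _) (by simp)]
  rfl

lemma QS_zero (n : ℕ) : QS n 0 = vac n := by
  have : LP n (Finset.univ.toList (α := BV n)) 0 = 1 := by
    unfold LP
    apply List.prod_eq_one
    intro a ha
    obtain ⟨x, _, rfl⟩ := List.mem_map.1 ha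
    simp
  simp [QS, this]

lemma occ_induction {n : ℕ} {p : OccT n → Prop} (h0 : p 0)
    (hs : ∀ u z, p u → p (Function.update u z (u z + 1))) (u : OccT n) : p u := by
  induction hk : ∑ x, u x generalizing u with
  | zero =>
    have : u = 0 := by
      funext x
      exact (Finset.sum_eq_zero_iff.1 hk) x (Finset.mem_univ x)
    rw [this]; exact h0
  | succ k ih =>
    obtain ⟨z, -, hz⟩ : ∃ z ∈ Finset.univ, u z ≠ 0 := by
      apply Finset.exists_ne_zero_of_sum_ne_zero
      omega
    have hz' : u z - 1 + 1 = u z := by omega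
    have h1 : u = Function.update (Function.update u z (u z - 1)) z
        ((Function.update u z (u z - 1)) z + 1) := by
      rw [Function.update_self, Function.update_idem, hz', Function.update_eq_self]
    rw [h1]
    apply hs
    apply ih
    rw [Finset.sum_update_of_mem (Finset.mem_univ z)]
    have := Finset.add_sum_erase Finset.univ u (Finset.mem_univ z)
    rw [Finset.erase_eq] at this
    omega

lemma mann_QS (n : ℕ) (x : BV n) (u : OccT n) :
    mann n x (QS n u) = (u x : ℂ) • QS n (Function.update u x (u x - 1)) := by
  induction u using occ_induction with
  | h0 => simp [QS_zero, mann_vac]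
  | hs u z ih =>
    have h1 : mann n x (mcre n z (QS n u)) =
        mcre n z (mann n x (QS n u)) + (if x = z then 1 else 0 : FockOp n) (QS n u) := by
      rw [← Module.End.mul_apply, mccr]; rfl
    rw [QS_succ, h1, ih, map_smul, ← QS_succ]
    by_cases h : x = z
    · subst h
      rw [if_pos rfl, Module.End.one_apply, Function.update_self, Function.update_idem,
        Function.update_self, Function.update_idem, Nat.add_sub_cancel, Function.update_eq_self]
      rcases Nat.eq_zero_or_pos (u x) with h0 | h0
      · simp [h0]
      · rw [Nat.sub_add_cancel h0, Function.update_eq_self]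
        push_cast
        rw [add_smul, one_smul]
    · rw [if_neg h, LinearMap.zero_apply, add_zero, Function.update_of_ne h,
        Function.update_of_ne (Ne.symm h), Function.update_comm h]

/-- normalization -/
noncomputable def nrm (n : ℕ) (u : OccT n) : ℝ := ∏ x : BV n, Real.sqrt ((u x).factorial)

lemma nrm_pos (n : ℕ) (u : OccT n) : 0 < nrm n u :=
  Finset.prod_pos fun x _ => Real.sqrt_pos.2 (by exact_mod_cast Nat.factorial_pos _)

lemma momFock_eq (n : ℕ) (u : OccT n) :
    momFock n u = (((nrm n u)⁻¹ : ℝ) : ℂ) • QS n u := rfl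

lemma nrm_succ (n : ℕ) (u : OccT n) (z : BV n) :
    nrm n (Function.update u z (u z + 1)) = Real.sqrt (u z + 1) * nrm n u := by
  unfold nrm
  rw [← Finset.mul_prod_erase Finset.univ _ (Finset.mem_univ z),
    ← Finset.mul_prod_erase Finset.univ (fun x => Real.sqrt ((u x).factorial)) (Finset.mem_univ z),
    ← mul_assoc]
  congr 1
  · rw [Function.update_self, Nat.factorial_succ, Nat.cast_mul, Real.sqrt_mul (by positivity)]
    push_cast
    rfl
  · refine Finset.prod_congr rfl fun x hx => ?_
    rw [Function.update_of_ne (Finset.ne_of_mem_erase hx)]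

lemma mcre_mom (n : ℕ) (x : BV n) (u : OccT n) :
    mcre n x (momFock n u) =
      ((Real.sqrt (u x + 1) : ℝ) : ℂ) • momFock n (Function.update u x (u x + 1)) := by
  rw [momFock_eq, momFock_eq, map_smul, QS_succ, smul_smul, nrm_succ, ← Complex.ofReal_mul]
  congr 2
  have := nrm_pos n u
  have : 0 < Real.sqrt (u x + 1) := Real.sqrt_pos.2 (by positivity)
  field_simp

lemma mann_mom (n : ℕ) (x : BV n) (u : OccT n) :
    mann n x (momFock n u) =
      ((Real.sqrt (u x) : ℝ) : ℂ) • momFock n (Function.update u x (u x - 1)) := by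
  rw [momFock_eq, momFock_eq, map_smul, mann_QS, smul_smul, smul_smul]
  rcases Nat.eq_zero_or_pos (u x) with h0 | h0
  · simp [h0]
  set v := Function.update u x (u x - 1) with hv
  have h1 : u = Function.update v x (v x + 1) := by
    rw [hv, Function.update_self, Function.update_idem, Nat.sub_add_cancel h0,
      Function.update_eq_self]
  have h2 : ((v x : ℝ) + 1) = u x := by
    conv_rhs => rw [h1]
    simp
  have h3 := nrm_succ n v x
  rw [← h1, h2] at h3
  rw [h3]
  congr 1
  rw [← Complex.ofReal_natCast, ← Complex.ofReal_mul, ← Complex.ofReal_mul]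
  congr 1
  have := nrm_pos n v
  have h4 : 0 < Real.sqrt (u x) := Real.sqrt_pos.2 (by exact_mod_cast h0)
  have h5 : Real.sqrt (u x) * Real.sqrt (u x) = u x := Real.mul_self_sqrt (by positivity)
  field_simp
  nlinarith

/-- The unitary (isometry). -/
noncomputable def UU (n : ℕ) : FockOp n := Finsupp.lift (FockV n) ℂ (OccT n) (momFock n)

lemma UU_single (n : ℕ) (u : OccT n) (a : ℂ) : UU n (Finsupp.single u a) = a • momFock n u := by
  simp [UU]

lemma mom_zero (n : ℕ) : momFock n 0 = vac n := by
  simp [momFock_eq, QS_zero, nrm]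

lemma mom_ortho (n : ℕ) (u w : OccT n) :
    finner n (momFock n u) (momFock n w) = if u = w then 1 else 0 := by
  induction u using occ_induction generalizing w with
  | h0 =>
    rw [mom_zero]
    by_cases h : w = 0
    · subst h
      rw [mom_zero]
      simp [vac, finner_single_left]
    · rw [if_neg (Ne.symm h)]
      obtain ⟨z, hz⟩ := Function.ne_iff.1 h
      have hz : 0 < w z := Nat.pos_of_ne_zero hz
      set v := Function.update w z (w z - 1) with hv
      have h1 : w = Function.update v z (v z + 1) := by
        rw [hv, Function.update_self, Function.update_idem, Nat.sub_add_cancel hz,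
          Function.update_eq_self]
      have h2 := mcre_mom n z v
      rw [← h1] at h2
      have h3 : finner n (vac n) (mcre n z (momFock n v)) = 0 := by
        rw [← finner_conj, mcre_adj, mann_vac, finner_zero_right, map_zero]
      rw [h2, finner_smul_right] at h3
      refine (mul_eq_zero.1 h3).resolve_left ?_
      exact Complex.ofReal_ne_zero.2 (Real.sqrt_pos.2 (by positivity)).ne'
  | hs u z ih =>
    have h2 := mcre_adj n z (momFock n u) (momFock n w)
    rw [mcre_mom, mann_mom, finner_smul_left, finner_smul_right, ih, Complex.conj_ofReal] at h2
    have h3 : ((Real.sqrt (u z + 1) : ℝ) : ℂ) ≠ 0 := by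
      rw [Complex.ofReal_ne_zero]
      exact (Real.sqrt_pos.2 (by positivity)).ne'
    apply mul_left_cancel₀ h3
    rw [h2]
    by_cases h : Function.update u z (u z + 1) = w
    · subst h
      simp
    · rw [if_neg h]
      by_cases h' : u = Function.update w z (w z - 1)
      · rcases Nat.eq_zero_or_pos (w z) with h0 | h0
        · simp [h0]
        · exfalso
          apply h
          rw [h', Function.update_self, Function.update_idem, Nat.sub_add_cancel h0,
            Function.update_eq_self]
      · rw [if_neg h']; simp

lemma UU_finner (n : ℕ) (φ ψ : FockV n) : finner n (UU n φ) (UU n ψ) = finner n φ ψ := by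
  induction φ using Finsupp.induction_linear with
  | zero => simp [finner_zero_left]
  | add f g hf hg => rw [map_add, finner_add_left, finner_add_left, hf, hg]
  | single u a =>
    induction ψ using Finsupp.induction_linear with
    | zero => simp [finner_zero_right]
    | add f g hf hg => rw [map_add, finner_add_right, finner_add_right, hf, hg]
    | single w b =>
      rw [UU_single, UU_single, finner_smul_left, finner_smul_right, mom_ortho,
        finner_single_left, Finsupp.single_apply]
      simp only [eq_comm]
      split_ifs <;> simp

lemma UU_nsq (n : ℕ) (φ : FockV n) : nsq n (UU n φ) = nsq n φ := by
  have := UU_finner n φ φ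
  rw [finner_self, finner_self] at this
  exact_mod_cast this

lemma bessel (n : ℕ) (S : Finset (OccT n)) (ψ : FockV n) :
    ∑ u ∈ S, Complex.normSq (finner n (momFock n u) ψ) ≤ nsq n ψ := by
  set c : OccT n → ℂ := fun u => finner n (momFock n u) ψ with hc
  set p : FockV n := ∑ u ∈ S, c u • momFock n u with hp
  have h1 : finner n p ψ = ((∑ u ∈ S, Complex.normSq (c u) : ℝ) : ℂ) := by
    rw [hp, finner_sum_left]
    push_cast
    refine Finset.sum_congr rfl fun u _ => ?_
    rw [finner_smul_left, Complex.normSq_eq_conj_mul_self]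
  have h2 : finner n ψ p = ((∑ u ∈ S, Complex.normSq (c u) : ℝ) : ℂ) := by
    rw [← finner_conj, h1, Complex.conj_ofReal]
  have h3 : finner n p p = ((∑ u ∈ S, Complex.normSq (c u) : ℝ) : ℂ) := by
    conv_lhs => rw [hp]
    rw [finner_sum_left]
    push_cast
    refine Finset.sum_congr rfl fun u hu => ?_
    rw [finner_smul_left, finner_sum_right, Finset.sum_eq_single u]
    · rw [finner_smul_right, mom_ortho, if_pos rfl, mul_one, Complex.normSq_eq_conj_mul_self]
    · intro w _ hw
      rw [finner_smul_right, mom_ortho, if_neg (Ne.symm hw), mul_zero]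
    · exact fun h => absurd hu h
  have h4 := finner_self n (ψ + (-1 : ℂ) • p)
  rw [finner_add_left, finner_add_right, finner_add_right, finner_smul_left, finner_smul_left,
    finner_smul_right, finner_smul_right, h1, h2, h3, finner_self] at h4
  have h5 := nsq_nonneg n (ψ + (-1 : ℂ) • p)
  have h6 : nsq n (ψ + (-1 : ℂ) • p) = nsq n ψ - ∑ u ∈ S, Complex.normSq (c u) := by
    have : ((nsq n (ψ + (-1 : ℂ) • p) : ℝ) : ℂ) =
        ((nsq n ψ - ∑ u ∈ S, Complex.normSq (c u) : ℝ) : ℂ) := by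
      rw [← h4]; push_cast; simp; ring
    exact_mod_cast this
  linarith

/-- sector -/
def sec (n ℓ : ℕ) : Finset (OccT n) := Finset.piAntidiag Finset.univ ℓ

lemma mem_sec {n ℓ : ℕ} {u : OccT n} : u ∈ sec n ℓ ↔ ∑ x, u x = ℓ := by
  simp [sec]

lemma projOn_apply (n ℓ : ℕ) (P : OccT n → Prop) [DecidablePred P] (ψ : FockV n) :
    projOn n ℓ P ψ =
      ∑ u ∈ (sec n ℓ).filter P, finner n (momFock n u) ψ • momFock n u := by
  have h0 : ∀ w : OccT n, (∑ v : BV n → Fin (ℓ + 1),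
      if (∑ x, ((v x : ℕ))) = ℓ ∧ P (fun x => (v x : ℕ))
      then (starRingEnd ℂ) (momFock n (fun x => (v x : ℕ)) w) • momFock n (fun x => (v x : ℕ))
      else 0) = ∑ u ∈ (sec n ℓ).filter P, (starRingEnd ℂ) (momFock n u w) • momFock n u := by
    intro w
    rw [← Finset.sum_filter]
    refine Finset.sum_bij (fun v _ => fun x => (v x : ℕ)) ?_ ?_ ?_ ?_
    · intro v hv
      simp only [Finset.mem_filter, Finset.mem_univ, true_and] at hv
      simp [mem_sec, hv]
    · intro v _ v' _ h
      funext x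
      exact Fin.ext (congrFun h x)
    · intro u hu
      rw [Finset.mem_filter, mem_sec] at hu
      have hle : ∀ x, u x < ℓ + 1 := fun x => by
        have := Finset.single_le_sum (f := u) (fun _ _ => Nat.zero_le _) (Finset.mem_univ x)
        omega
      exact ⟨fun x => ⟨u x, hle x⟩, by simpa using hu, rfl⟩
    · intro v _; rfl
  induction ψ using Finsupp.induction_linear with
  | zero => simp [finner_zero_right]
  | add f g hf hg =>
    rw [map_add, hf, hg, ← Finset.sum_add_distrib]
    exact Finset.sum_congr rfl fun u _ => by rw [finner_add_right, add_smul]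
  | single w b =>
    have : projOn n ℓ P (Finsupp.single w b) = b • ∑ u ∈ (sec n ℓ).filter P,
        (starRingEnd ℂ) (momFock n u w) • momFock n u := by
      rw [← h0]
      simp [projOn]
    rw [this, Finset.smul_sum]
    refine Finset.sum_congr rfl fun u _ => ?_
    rw [← finner_conj, finner_single_left, smul_smul]
    simp

lemma projOn_mom (n ℓ : ℕ) (P : OccT n → Prop) [DecidablePred P] (w : OccT n) 
    (hw : w ∈ sec n ℓ) :
    projOn n ℓ P (momFock n w) = if P w then momFock n w else 0 := by
  rw [projOn_apply]
  simp only [mom_ortho]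
  split_ifs with h
  · rw [Finset.sum_eq_single w]
    · simp
    · intro u _ hu; simp [hu]
    · intro h'; exact absurd (Finset.mem_filter.2 ⟨hw, h⟩) h'
  · refine Finset.sum_eq_zero fun u hu => ?_
    have : u ≠ w := by rintro rfl; exact h (Finset.mem_filter.1 hu).2
    simp [this]

/-! Hopping combinatorics -/

def t1 {n : ℕ} (u : OccT n) (x' : BV n) : OccT n := Function.update u x' (u x' - 1)
def t2 {n : ℕ} (u : OccT n) (x x' : BV n) : OccT n :=
  Function.update (t1 u x') x (t1 u x' x - 1)
def t3 {n : ℕ} (y : BV n) (u : OccT n) (x x' : BV n) : OccT n :=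
  Function.update (t2 u x x') (x' + y) (t2 u x x' (x' + y) + 1)
def t4 {n : ℕ} (y : BV n) (u : OccT n) (x x' : BV n) : OccT n :=
  Function.update (t3 y u x x') (x + y) (t3 y u x x' (x + y) + 1)

/-- The amplitude. -/
noncomputable def amp {n : ℕ} (y : BV n) (u : OccT n) (x x' : BV n) : ℝ :=
  Real.sqrt (u x') * Real.sqrt (t1 u x' x) * Real.sqrt (t2 u x x' (x' + y) + 1) *
    Real.sqrt (t3 y u x x' (x + y) + 1)

lemma dHop_mom (n ℓ : ℕ) (y : BV n) (u : OccT n) :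
    dHop n ℓ y (momFock n u) = ∑ x : BV n, ∑ x' : BV n,
      ((((ℓ : ℝ)⁻¹ * amp y u x x' : ℝ)) : ℂ) • momFock n (t4 y u x x') := by
  unfold dHop
  simp only [LinearMap.smul_apply, LinearMap.sum_apply, Module.End.mul_apply, Finset.smul_sum]
  refine Finset.sum_congr rfl fun x _ => Finset.sum_congr rfl fun x' _ => ?_
  simp only [mann_mom, mcre_mom, map_smul, smul_smul]
  change _ • momFock n (t4 y u x x') = _
  congr 1
  unfold amp
  push_cast
  simp only [mul_assoc]
  rfl

lemma amp_pos {n : ℕ} {y : BV n} {u : OccT n} {x x' : BV n} (h : amp y u x x' ≠ 0) :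
    0 < u x' ∧ 0 < t1 u x' x := by
  constructor
  · rcases Nat.eq_zero_or_pos (u x') with h0 | h0
    · exact absurd (by simp [amp, h0]) h
    · exact h0
  · rcases Nat.eq_zero_or_pos (t1 u x' x) with h0 | h0
    · exact absurd (by simp [amp, h0]) h
    · exact h0

lemma t4_formula {n : ℕ} (y : BV n) (u : OccT n) (x x' : BV n) (h1 : 0 < u x')
    (h2 : 0 < t1 u x' x) (z : BV n) :
    t4 y u x x' z + (if z = x' then 1 else 0) + (if z = x then 1 else 0)
      = u z + (if z = x' + y then 1 else 0) + (if z = x + y then 1 else 0) := by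
  have e4 : t4 y u x x' z = t3 y u x x' z + (if z = x + y then 1 else 0) := by
    unfold t4; rw [Function.update_apply]; split_ifs with h <;> simp [h]
  have e3 : t3 y u x x' z = t2 u x x' z + (if z = x' + y then 1 else 0) := by
    unfold t3; rw [Function.update_apply]; split_ifs with h <;> simp [h]
  have e2 : t2 u x x' z + (if z = x then 1 else 0) = t1 u x' z := by
    unfold t2; rw [Function.update_apply]; split_ifs with h
    · rw [h]; omega
    · simp
  have e1 : t1 u x' z + (if z = x' then 1 else 0) = u z := by
    unfold t1; rw [Function.update_apply]; split_ifs with h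
    · rw [h]; omega
    · simp
  omega

lemma t4_sum {n : ℕ} (y : BV n) (u : OccT n) (x x' : BV n) (h1 : 0 < u x')
    (h2 : 0 < t1 u x' x) : ∑ z, t4 y u x x' z = ∑ z, u z := by
  have := Finset.sum_congr (rfl : (Finset.univ : Finset (BV n)) = Finset.univ)
    (fun z _ => t4_formula y u x x' h1 h2 z)
  simp only [Finset.sum_add_distrib, Finset.sum_ite_eq', Finset.mem_univ, if_true] at this
  omega

lemma t4_inj {n : ℕ} (y : BV n) (u v : OccT n) (x x' : BV n) (h1 : 0 < u x')
    (h2 : 0 < t1 u x' x) (h1' : 0 < v x') (h2' : 0 < t1 v x' x)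
    (h : t4 y u x x' = t4 y v x x') : u = v := by
  funext z
  have a := t4_formula y u x x' h1 h2 z
  have b := t4_formula y v x x' h1' h2' z
  rw [h] at a
  omega

lemma t4_pos {n : ℕ} (y : BV n) (u : OccT n) (x x' : BV n) :
    t4 y u x x' (x + y) ≠ 0 ∧ t4 y u x x' (x' + y) ≠ 0 := by
  constructor
  · simp [t4]
  · unfold t4
    rw [Function.update_apply]
    split_ifs
    · simp
    · simp [t3]

lemma t4_odd {n : ℕ} (y : BV n) (u : OccT n) (x x' : BV n) (h1 : 0 < u x')
    (h2 : 0 < t1 u x' x) (hx : x = 0 ∨ x = y) (hx' : x' = 0 ∨ x' = y) :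
    oddCount n (t4 y u x x') = oddCount n u := by
  unfold oddCount
  congr 1
  refine Finset.filter_congr fun z _ => ?_
  refine and_congr_right fun hz => ?_
  have h := t4_formula y u x x' h1 h2 z
  have hyy : y + y = 0 := (add_eq_zero_iff' y y).2 rfl
  rw [Nat.odd_iff, Nat.odd_iff]
  rcases hx with rfl | rfl <;> rcases hx' with rfl | rfl <;>
    simp only [hz, hyy, zero_add, if_false] at h <;> split_ifs at h <;> omega

lemma supp_card {n ℓ : ℕ} (w : OccT n) (hw : ∑ z, w z = ℓ) :
    (Finset.univ.filter fun z => w z ≠ 0).card + w 0 ≤ ℓ + 1 := by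
  have h : ∑ z : BV n, ((if w z ≠ 0 then 1 else 0) + (if z = 0 then w 0 else 0))
      ≤ ∑ z : BV n, (w z + (if z = 0 then 1 else 0)) := by
    refine Finset.sum_le_sum fun z _ => ?_
    by_cases hz : z = 0
    · subst hz
      simp
      split_ifs <;> omega
    · simp only [hz, if_false]
      split_ifs <;> omega
  simp only [Finset.sum_add_distrib, Finset.sum_ite_eq', Finset.mem_univ, if_true] at h
  rw [Finset.card_filter]
  omega

lemma pt_le {n ℓ : ℕ} (w : OccT n) (hw : ∑ z, w z = ℓ) (z : BV n) (hz : z ≠ 0) :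
    w z + w 0 ≤ ℓ := by
  rw [← hw, ← Finset.sum_pair hz]
  exact Finset.sum_le_sum_of_subset (Finset.subset_univ _)

lemma amp_sq {n ℓ R : ℕ} (hRℓ : R ≤ ℓ) (y : BV n) (hy : y ≠ 0) (u : OccT n)
    (hu : ∑ z, u z = ℓ) (hc : ℓ - R ≤ u 0) (x x' : BV n)
    (hb : ¬ ((x = 0 ∨ x = y) ∧ (x' = 0 ∨ x' = y))) :
    amp y u x x' ^ 2 ≤ ((ℓ : ℝ) + 2) * ((R : ℝ) + 2) ^ 3 := by
  have e1 : ∀ z, t1 u x' z ≤ u z := fun z => by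
    unfold t1; rw [Function.update_apply]; split_ifs with h
    · rw [h]; omega
    · simp
  have e2 : ∀ z, t2 u x x' z ≤ u z := fun z => by
    refine le_trans ?_ (e1 z)
    unfold t2; rw [Function.update_apply]; split_ifs with h
    · rw [h]; omega
    · simp
  have e3 : ∀ z, t3 y u x x' z ≤ u z + 1 := fun z => by
    have := e2 z
    unfold t3; rw [Function.update_apply]; split_ifs with h
    · rw [← h]; omega
    · omega
  have hsq : amp y u x x' ^ 2 = ((u x' * t1 u x' x * (t2 u x x' (x' + y) + 1) *
      (t3 y u x x' (x + y) + 1) : ℕ) : ℝ) := by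
    unfold amp
    rw [mul_pow, mul_pow, mul_pow, Real.sq_sqrt (by positivity), Real.sq_sqrt (by positivity),
      Real.sq_sqrt (by positivity), Real.sq_sqrt (by positivity)]
    push_cast
    rfl
  rw [hsq]
  have hle : u x' * t1 u x' x * (t2 u x x' (x' + y) + 1) * (t3 y u x x' (x + y) + 1)
      ≤ (u x' + 2) * (u x + 2) * (u (x' + y) + 2) * (u (x + y) + 2) := by
    have := e1 x
    have := e2 (x' + y)
    have := e3 (x + y)
    exact Nat.mul_le_mul (Nat.mul_le_mul (Nat.mul_le_mul (by omega) (by omega)) (by omega))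
      (by omega)
  have big : ∀ z, u z + 2 ≤ ℓ + 2 := fun z => by
    have := Finset.single_le_sum (f := u) (fun _ _ => Nat.zero_le _) (Finset.mem_univ z)
    omega
  have small : ∀ z, z ≠ 0 → u z + 2 ≤ R + 2 := fun z hz => by
    have := pt_le u hu z hz
    omega
  have nz : ∀ z, ¬ (z = 0 ∨ z = y) → z ≠ 0 ∧ z + y ≠ 0 := fun z hz =>
    ⟨fun h => hz (Or.inl h), fun h => hz (Or.inr ((add_eq_zero_iff' z y).1 h))⟩
  have one : ∀ z, (u z + 2) * (u (z + y) + 2) ≤ (ℓ + 2) * (R + 2) := fun z => by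
    by_cases hz : z = 0
    · have : z + y ≠ 0 := by rw [hz, zero_add]; exact hy
      exact Nat.mul_le_mul (big _) (small _ this)
    · rw [mul_comm]
      exact Nat.mul_le_mul (big _) (small _ hz)
  have fin : (u x' + 2) * (u x + 2) * (u (x' + y) + 2) * (u (x + y) + 2)
      ≤ (ℓ + 2) * (R + 2) ^ 3 := by
    have two : ∀ z, ¬ (z = 0 ∨ z = y) → (u z + 2) * (u (z + y) + 2) ≤ (R + 2) * (R + 2) :=
      fun z hz => Nat.mul_le_mul (small _ (nz z hz).1) (small _ (nz z hz).2)
    have re : (u x' + 2) * (u x + 2) * (u (x' + y) + 2) * (u (x + y) + 2) =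
      ((u x' + 2) * (u (x' + y) + 2)) * ((u x + 2) * (u (x + y) + 2)) := by ring
    rw [re]
    by_cases hx : x = 0 ∨ x = y
    · have hx' : ¬ (x' = 0 ∨ x' = y) := fun h => hb ⟨hx, h⟩
      calc _ ≤ ((R + 2) * (R + 2)) * ((ℓ + 2) * (R + 2)) := Nat.mul_le_mul (two x' hx') (one x)
        _ = _ := by ring
    · calc _ ≤ ((ℓ + 2) * (R + 2)) * ((R + 2) * (R + 2)) := Nat.mul_le_mul (one x') (two x hx)
        _ = _ := by ring
  have := hle.trans fin
  exact_mod_cast this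

/-! Cauchy–Schwarz -/

lemma nsq_eq_sum (n : ℕ) (φ : FockV n) (F : Finset (OccT n)) (hF : φ.support ⊆ F) :
    nsq n φ = ∑ w ∈ F, Complex.normSq (φ w) :=
  Finsupp.sum_of_support_subset _ hF _ (by simp)

lemma cs_bound {ι : Type*} (n : ℕ) (I : Finset ι) (c : ι → ℂ) (T : ι → OccT n) (K : ℕ)
    (hK : ∀ w, (I.filter fun t => T t = w).card ≤ K) :
    nsq n (∑ t ∈ I, c t • Finsupp.single (T t) 1) ≤ K * ∑ t ∈ I, Complex.normSq (c t) := by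
  classical
  have hval : ∀ w, (∑ t ∈ I, c t • Finsupp.single (T t) (1 : ℂ)) w
      = ∑ t ∈ I.filter (fun t => T t = w), c t := by
    intro w
    rw [Finsupp.finsetSum_apply, Finset.sum_filter]
    refine Finset.sum_congr rfl fun t _ => ?_
    rw [Finsupp.smul_apply, Finsupp.single_apply]
    split_ifs <;> simp
  rw [nsq_eq_sum n _ (I.image T)]
  · rw [← Finset.sum_fiberwise_of_maps_to (g := T) (t := I.image T) (f := fun t => Complex.normSq (c t))
      (fun t ht => Finset.mem_image_of_mem T ht), Finset.mul_sum]
    refine Finset.sum_le_sum ?_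
    intro w _
    rw [hval]
    set J := I.filter (fun t => T t = w)
    have h1 : ‖∑ t ∈ J, c t‖ ^ 2 ≤ (∑ t ∈ J, ‖c t‖) ^ 2 := by
      have h0 : ‖∑ t ∈ J, c t‖ ≤ ∑ t ∈ J, ‖c t‖ := norm_sum_le J c
      exact pow_le_pow_left₀ (norm_nonneg _) h0 2
    have h2 : (∑ t ∈ J, ‖c t‖) ^ 2 ≤ (J.card : ℝ) * ∑ t ∈ J, ‖c t‖ ^ 2 :=
      sq_sum_le_card_mul_sum_sq
    have h3 : (J.card : ℝ) ≤ K := by exact_mod_cast hK w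
    simp only [Complex.normSq_eq_norm_sq]
    refine h1.trans (h2.trans ?_)
    gcongr
  · intro w hw
    rw [Finsupp.mem_support_iff, hval] at hw
    obtain ⟨t, ht, -⟩ := Finset.exists_ne_zero_of_sum_ne_zero hw
    rw [Finset.mem_filter] at ht
    exact Finset.mem_image.2 ⟨t, ht.1, ht.2⟩

/-- The index set of bad hops. -/
noncomputable def badI (n ℓ R : ℕ) (y : BV n) : Finset (OccT n × BV n × BV n) := by
  classical
  exact (sec n ℓ ×ˢ (Finset.univ ×ˢ Finset.univ)).filter fun t =>
    (ℓ - R ≤ t.1 0 ∧ oddCount n t.1 ≤ R) ∧ amp y t.1 t.2.1 t.2.2 ≠ 0 ∧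
      oddCount n (t4 y t.1 t.2.1 t.2.2) ≠ oddCount n t.1

lemma mem_badI {n ℓ R : ℕ} {y : BV n} {t : OccT n × BV n × BV n} :
    t ∈ badI n ℓ R y ↔ (∑ z, t.1 z = ℓ) ∧ (ℓ - R ≤ t.1 0 ∧ oddCount n t.1 ≤ R) ∧
      amp y t.1 t.2.1 t.2.2 ≠ 0 ∧ oddCount n (t4 y t.1 t.2.1 t.2.2) ≠ oddCount n t.1 := by
  simp [badI, mem_sec]

lemma op_apply (n ℓ R : ℕ) (y : BV n) (ψ : FockV n) :
    (∑ o ∈ Finset.range (R + 1),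
          ((1 : FockOp n) - QEeq n ℓ o) * dHop n ℓ y * QECeq n ℓ R o) ψ =
    UU n (∑ t ∈ badI n ℓ R y, (finner n (momFock n t.1) ψ *
      (((ℓ : ℝ)⁻¹ * amp y t.1 t.2.1 t.2.2 : ℝ) : ℂ)) •
        Finsupp.single (t4 y t.1 t.2.1 t.2.2) 1) := by
  classical
  have hterm : ∀ o, (((1 : FockOp n) - QEeq n ℓ o) * dHop n ℓ y * QECeq n ℓ R o) ψ =
      ∑ u ∈ sec n ℓ, if (ℓ - R ≤ u 0 ∧ oddCount n u = o) then
        ∑ x : BV n, ∑ x' : BV n,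
          if amp y u x x' ≠ 0 ∧ oddCount n (t4 y u x x') ≠ oddCount n u then
            (finner n (momFock n u) ψ * (((ℓ : ℝ)⁻¹ * amp y u x x' : ℝ) : ℂ)) •
              momFock n (t4 y u x x') else 0
        else 0 := by
    intro o
    simp only [Module.End.mul_apply]
    rw [QECeq, projOn_apply, map_sum, map_sum, Finset.sum_filter]
    refine Finset.sum_congr rfl fun u hu => ?_
    split_ifs with hP
    · rw [map_smul, dHop_mom]
      simp only [Finset.smul_sum, map_sum, smul_smul]
      refine Finset.sum_congr rfl fun x _ => Finset.sum_congr rfl fun x' _ => ?_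
      by_cases ha : amp y u x x' = 0
      · simp [ha]
      · obtain ⟨h1, h2⟩ := amp_pos ha
        have hT : t4 y u x x' ∈ sec n ℓ := by
          rw [mem_sec, t4_sum y u x x' h1 h2]; exact mem_sec.1 hu
        rw [map_smul, LinearMap.sub_apply, Module.End.one_apply, QEeq, projOn_mom _ _ _ _ hT,
          hP.2]
        by_cases ho : oddCount n (t4 y u x x') = o
        · simp [ho]
        · simp [ho, ha]
    · rfl
  rw [LinearMap.sum_apply]
  simp only [hterm]
  rw [Finset.sum_comm, map_sum]
  simp only [map_smul, UU_single, one_smul]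
  unfold badI
  rw [Finset.sum_filter, Finset.sum_product]
  refine Finset.sum_congr rfl fun u _ => ?_
  rw [Finset.sum_product]
  by_cases hc : ℓ - R ≤ u 0 ∧ oddCount n u ≤ R
  · rw [Finset.sum_eq_single (oddCount n u)]
    · simp only [hc, and_self, true_and, if_true]
    · intro o _ ho
      rw [if_neg]
      exact fun h => ho h.2.symm
    · intro h
      exact absurd (Finset.mem_range.2 (by omega)) h
  · rw [Finset.sum_eq_zero]
    · simp only [hc, false_and, if_false, Finset.sum_const_zero]
    · intro o ho
      rw [if_neg]
      rintro ⟨h1, rfl⟩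
      exact hc ⟨h1, by have := Finset.mem_range.1 ho; omega⟩

lemma row_count (n ℓ R : ℕ) (y : BV n) (w : OccT n) :
    ((badI n ℓ R y).filter fun t => t4 y t.1 t.2.1 t.2.2 = w).card ≤ (R + 3) ^ 2 := by
  classical
  rcases Finset.eq_empty_or_nonempty
    ((badI n ℓ R y).filter fun t => t4 y t.1 t.2.1 t.2.2 = w) with h | ⟨t, ht⟩
  · rw [h]; simp
  rw [Finset.mem_filter, mem_badI] at ht
  obtain ⟨⟨hs, ⟨hc, -⟩, ha, -⟩, hw⟩ := ht
  obtain ⟨h1, h2⟩ := amp_pos ha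
  have hws : ∑ z, w z = ℓ := by rw [← hw, t4_sum y _ _ _ h1 h2, hs]
  have hw0 : t.1 0 ≤ w 0 + 2 := by
    have := t4_formula y _ _ _ h1 h2 0
    rw [hw] at this
    split_ifs at this <;> omega
  have hcard := supp_card w hws
  set S := Finset.univ.filter fun z => w z ≠ 0 with hS
  have hS3 : S.card ≤ R + 3 := by omega
  have hle : ((badI n ℓ R y).filter fun t => t4 y t.1 t.2.1 t.2.2 = w).card ≤ (S ×ˢ S).card := by
    refine Finset.card_le_card_of_injOn (fun t => (t.2.1 + y, t.2.2 + y)) ?_ ?_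
    · intro s hs
      have hs := Finset.mem_coe.1 hs
      rw [Finset.mem_filter] at hs
      have := t4_pos y s.1 s.2.1 s.2.2
      rw [hs.2] at this
      simp [hS, this]
    · intro s hs s' hs' he
      have hs := Finset.mem_coe.1 hs
      have hs' := Finset.mem_coe.1 hs'
      rw [Finset.mem_filter, mem_badI] at hs hs'
      obtain ⟨u, x, x'⟩ := s
      obtain ⟨v, z, z'⟩ := s'
      simp only [Prod.mk.injEq, add_left_inj] at he
      obtain ⟨rfl, rfl⟩ := he
      obtain ⟨a1, a2⟩ := amp_pos hs.1.2.2.1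
      obtain ⟨b1, b2⟩ := amp_pos hs'.1.2.2.1
      have := t4_inj y u v x x' a1 a2 b1 b2 (hs.2.trans hs'.2.symm)
      rw [this]
  refine hle.trans ?_
  rw [Finset.card_product, sq]
  exact Nat.mul_le_mul hS3 hS3

lemma col_count (n ℓ R : ℕ) (y : BV n) (u : OccT n) :
    ((badI n ℓ R y).filter fun t => t.1 = u).card ≤ (R + 1) ^ 2 := by
  classical
  rcases Finset.eq_empty_or_nonempty
    ((badI n ℓ R y).filter fun t => t.1 = u) with h | ⟨t, ht⟩
  · rw [h]; simp
  rw [Finset.mem_filter, mem_badI] at ht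
  obtain ⟨⟨hs, ⟨hc, -⟩, -, -⟩, hw⟩ := ht
  rw [hw] at hs hc
  have hcard := supp_card u hs
  set S := Finset.univ.filter fun z => u z ≠ 0 with hS
  have hS3 : S.card ≤ R + 1 := by omega
  have hle : ((badI n ℓ R y).filter fun t => t.1 = u).card ≤ (S ×ˢ S).card := by
    refine Finset.card_le_card_of_injOn (fun t => t.2) ?_ ?_
    · intro s hs
      have hs := Finset.mem_coe.1 hs
      rw [Finset.mem_filter, mem_badI] at hs
      obtain ⟨a1, a2⟩ := amp_pos hs.1.2.2.1
      have a3 : t1 s.1 s.2.2 s.2.1 ≤ s.1 s.2.1 := by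
        unfold t1; rw [Function.update_apply]; split_ifs with h
        · rw [h]; omega
        · simp
      rw [hs.2] at a1 a2 a3
      have a4 : u s.2.1 ≠ 0 := by omega
      simp [hS, a1.ne', a4]
    · intro s hs s' hs' he
      have hs := Finset.mem_coe.1 hs
      have hs' := Finset.mem_coe.1 hs'
      rw [Finset.mem_filter] at hs hs'
      exact Prod.ext (hs.2.trans hs'.2.symm) he
  refine hle.trans ?_
  rw [Finset.card_product, sq]
  exact Nat.mul_le_mul hS3 hS3

lemma bad_sum (n ℓ R : ℕ) (hRℓ : R ≤ ℓ) (y : BV n) (hy : y ≠ 0) (ψ : FockV n) :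
    ∑ t ∈ badI n ℓ R y, Complex.normSq (finner n (momFock n t.1) ψ *
      (((ℓ : ℝ)⁻¹ * amp y t.1 t.2.1 t.2.2 : ℝ) : ℂ)) ≤
    (((ℓ : ℝ)⁻¹) ^ 2 * (((ℓ : ℝ) + 2) * ((R : ℝ) + 2) ^ 3)) * (((R : ℝ) + 1) ^ 2 * nsq n ψ) := by
  classical
  have h1 : ∀ t ∈ badI n ℓ R y, Complex.normSq (finner n (momFock n t.1) ψ *
      (((ℓ : ℝ)⁻¹ * amp y t.1 t.2.1 t.2.2 : ℝ) : ℂ)) ≤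
      (((ℓ : ℝ)⁻¹) ^ 2 * (((ℓ : ℝ) + 2) * ((R : ℝ) + 2) ^ 3)) *
        Complex.normSq (finner n (momFock n t.1) ψ) := by
    intro t ht
    rw [mem_badI] at ht
    obtain ⟨hs, ⟨hc, -⟩, ha, ho⟩ := ht
    obtain ⟨p1, p2⟩ := amp_pos ha
    have := amp_sq hRℓ y hy t.1 hs hc t.2.1 t.2.2
      (fun h => ho (t4_odd y _ _ _ p1 p2 h.1 h.2))
    rw [Complex.normSq_mul, Complex.normSq_ofReal, mul_comm, ← sq, mul_pow]
    have hn := Complex.normSq_nonneg (finner n (momFock n t.1) ψ)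
    gcongr
  refine (Finset.sum_le_sum h1).trans ?_
  rw [← Finset.mul_sum]
  refine mul_le_mul_of_nonneg_left ?_ (by positivity)
  have h2 : ∀ t ∈ badI n ℓ R y, t.1 ∈ sec n ℓ := fun t ht => mem_sec.2 (mem_badI.1 ht).1
  rw [← Finset.sum_fiberwise_of_maps_to h2]
  refine le_trans (Finset.sum_le_sum (g := fun u =>
    ((R : ℝ) + 1) ^ 2 * Complex.normSq (finner n (momFock n u) ψ)) fun u _ => ?_) ?_
  · rw [Finset.sum_congr rfl (g := fun _ => Complex.normSq (finner n (momFock n u) ψ))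
      (fun t ht => by rw [(Finset.mem_filter.1 ht).2]), Finset.sum_const, nsmul_eq_mul]
    refine mul_le_mul_of_nonneg_right ?_ (Complex.normSq_nonneg _)
    exact_mod_cast col_count n ℓ R y u
  · rw [← Finset.mul_sum]
    exact mul_le_mul_of_nonneg_left (bessel n _ ψ) (by positivity)

lemma final_num (ℓ R : ℝ) (hR : 16 ≤ R) (hℓ : R ≤ ℓ) :
    (R + 3) ^ 2 * ((ℓ⁻¹ ^ 2 * ((ℓ + 2) * (R + 2) ^ 3)) * (R + 1) ^ 2) ≤ R ^ 10 / ℓ := by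
  have hl : 0 < ℓ := by linarith
  have h1 : R + 3 ≤ 2 * R := by linarith
  have h2 : R + 2 ≤ 2 * R := by linarith
  have h3 : R + 1 ≤ 2 * R := by linarith
  have h4 : ℓ + 2 ≤ 2 * ℓ := by linarith
  have hR0 : 0 ≤ R := by linarith
  have h5 : (R + 3) ^ 2 * ((ℓ⁻¹ ^ 2 * ((ℓ + 2) * (R + 2) ^ 3)) * (R + 1) ^ 2) ≤
      (2 * R) ^ 2 * ((ℓ⁻¹ ^ 2 * ((2 * ℓ) * (2 * R) ^ 3)) * (2 * R) ^ 2) := by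
    gcongr
  have h6 : (2 * R) ^ 2 * ((ℓ⁻¹ ^ 2 * ((2 * ℓ) * (2 * R) ^ 3)) * (2 * R) ^ 2)
      = 256 * R ^ 7 / ℓ := by
    field_simp
    ring
  refine h5.trans (h6.le.trans ?_)
  apply div_le_div_of_nonneg_right _ hl.le
  have h7 : (16 : ℝ) ^ 3 ≤ R ^ 3 := by gcongr
  calc 256 * R ^ 7 ≤ R ^ 3 * R ^ 7 := by gcongr; linarith
    _ = R ^ 10 := by ring

end DHQ

/-- the double-hopping operator almost preserves quasi-evenness.
For `16 ≤ R ≤ ℓ` and `y ≠ 0`,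
`‖∑_{o=0}^{R} (id − QE_{=o}) · H̃_y · QEC_{(R,=o)}‖ ≤ R⁵/√ℓ` on the `ℓ`-boson space. -/
theorem double_hop_quasi_even (n ℓ R : ℕ) (hR16 : 16 ≤ R) (hRℓ : R ≤ ℓ)
    (y : BV n) (hy : y ≠ 0) :
    ∀ ψ : FockV n,
      nsq n ((∑ o ∈ Finset.range (R + 1),
          ((1 : FockOp n) - QEeq n ℓ o) * dHop n ℓ y * QECeq n ℓ R o) ψ)
        ≤ ((R : ℝ) ^ 5 / Real.sqrt (ℓ : ℝ)) ^ 2 * nsq n ψ := by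
  intro ψ
  rw [DHQ.op_apply, DHQ.UU_nsq]
  have h0 := DHQ.cs_bound n (DHQ.badI n ℓ R y) (fun t => finner n (momFock n t.1) ψ *
      (((ℓ : ℝ)⁻¹ * DHQ.amp y t.1 t.2.1 t.2.2 : ℝ) : ℂ)) (fun t => DHQ.t4 y t.1 t.2.1 t.2.2)
      ((R + 3) ^ 2) (DHQ.row_count n ℓ R y)
  have h1 := DHQ.bad_sum n ℓ R hRℓ y hy ψ
  refine h0.trans ?_
  clear h0
  revert h1
  generalize (∑ t ∈ DHQ.badI n ℓ R y, Complex.normSq (finner n (momFock n t.1) ψ *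
      (((ℓ : ℝ)⁻¹ * DHQ.amp y t.1 t.2.1 t.2.2 : ℝ) : ℂ))) = A
  intro h1
  have h4 := DHQ.nsq_nonneg n ψ
  generalize nsq n ψ = B at h1 h4 ⊢
  have hR' : (16 : ℝ) ≤ R := by exact_mod_cast hR16
  have hℓ' : (R : ℝ) ≤ ℓ := by exact_mod_cast hRℓ
  have h2 := DHQ.final_num ℓ R hR' hℓ'
  have h3 : ((R : ℝ) ^ 5 / Real.sqrt (ℓ : ℝ)) ^ 2 = (R : ℝ) ^ 10 / ℓ := by
    rw [div_pow, Real.sq_sqrt (by positivity), ← pow_mul]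
  rw [h3]
  have h5 := mul_le_mul_of_nonneg_right h2 h4
  have h6 := mul_le_mul_of_nonneg_left h1 (sq_nonneg ((R : ℝ) + 3))
  push_cast
  refine h6.trans (le_trans (le_of_eq ?_) h5)
  simp only [mul_assoc]
end
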